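/- arXiv:2008.10564 — 4 statements merged into one kernel-verified Lean document; each statement's English description precedes it below -/
import Mathlib

section
/- Let d ≥ 2 be an integer, let 0 < p < 1/(d-1), and let θ ∈ (0,1]. Then the lower and upper θ-intermediate dimensions of the set C_p^d of concentric spheres both equal (d·p·(d-1) + d·θ·(1 - p(d-1))) / (d·p + θ·(1 - p(d-1))), i.e. lodim_θ(C_p^d) = updim_θ(C_p^d) = (dp(d-1) + dθ(1-p(d-1)))/(dp + θ(1-p(d-1))). -/
open Set Metric Filter

/-- The upper θ-intermediate dimension of a set `E` in a metric space:
the infimum of all `s ≥ 0` such that for every `ε > 0` there is `δ₀ > 0` such that for all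
`0 < δ < δ₀` there is a countable cover `𝒰` of `E` with `δ ≤ diam U ≤ δ ^ θ` for all `U ∈ 𝒰`
and `∑_{U ∈ 𝒰} (diam U) ^ s ≤ ε`. -/
noncomputable def updim {X : Type*} [PseudoMetricSpace X] (θ : ℝ) (E : Set X) : ℝ :=
  sInf {s : ℝ | 0 ≤ s ∧ ∀ ε : ℝ, 0 < ε → ∃ δ₀ : ℝ, 0 < δ₀ ∧ ∀ δ : ℝ, 0 < δ → δ < δ₀ →
    ∃ 𝒰 : Set (Set X), 𝒰.Countable ∧ E ⊆ ⋃₀ 𝒰 ∧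
      (∀ U ∈ 𝒰, δ ≤ diam U ∧ diam U ≤ δ ^ θ) ∧
      ∑' U : 𝒰, ENNReal.ofReal (diam (U : Set X) ^ s) ≤ ENNReal.ofReal ε}

/-- The lower θ-intermediate dimension of a set `E` in a metric space. -/
noncomputable def lodim {X : Type*} [PseudoMetricSpace X] (θ : ℝ) (E : Set X) : ℝ :=
  sInf {s : ℝ | 0 ≤ s ∧ ∀ ε : ℝ, 0 < ε → ∀ δ₀ : ℝ, 0 < δ₀ → ∃ δ : ℝ, 0 < δ ∧ δ < δ₀ ∧
    ∃ 𝒰 : Set (Set X), 𝒰.Countable ∧ E ⊆ ⋃₀ 𝒰 ∧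
      (∀ U ∈ 𝒰, δ ≤ diam U ∧ diam U ≤ δ ^ θ) ∧
      ∑' U : 𝒰, ENNReal.ofReal (diam (U : Set X) ^ s) ≤ ENNReal.ofReal ε}

/-- `C_p^d`: the union over `n ≥ 1` of the spheres in `ℝ^d` of radius `n^{-p}` centred at
the origin. -/
noncomputable def concentric (d : ℕ) (p : ℝ) : Set (EuclideanSpace ℝ (Fin d)) :=
  {x | ∃ n : ℕ, 1 ≤ n ∧ ‖x‖ = (n : ℝ) ^ (-p)}

open MeasureTheory in
lemma cap_bound (d : ℕ) (hd : 2 ≤ d) (w : sphere (0 : EuclideanSpace ℝ (Fin d)) 1) (ρ : ℝ)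
    (hρ : 0 < ρ) :
    (volume : Measure (EuclideanSpace ℝ (Fin d))).toSphere (closedBall w ρ) ≤
      ENNReal.ofReal (2 ^ d * ρ ^ (d - 1) *
        (volume : Measure (EuclideanSpace ℝ (Fin d))).real (ball 0 1)) := by
  have : NeZero d := ⟨by omega⟩
  set μ : Measure (EuclideanSpace ℝ (Fin d)) := volume with hμ
  set V := μ.real (ball 0 1) with hV
  have hdim : Module.finrank ℝ (EuclideanSpace ℝ (Fin d)) = d := by simp
  rw [Measure.toSphere_apply' _ isClosed_closedBall.measurableSet, hdim]
  set K : Set (EuclideanSpace ℝ (Fin d)) :=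
    image2 (fun (t : ℝ) x => t • x) (Ioo (0 : ℝ) 1) ((↑) '' closedBall w ρ) with hK
  change (d : ENNReal) * μ K ≤ _
  have hKb : K ⊆ ball 0 1 := by
    rintro _ ⟨t, ht, _, ⟨x, hx, rfl⟩, rfl⟩
    have : ‖(x : EuclideanSpace ℝ (Fin d))‖ = 1 := by simp
    simp [norm_smul, abs_of_pos ht.1, ht.2]
  have hKfin : μ K ≠ ⊤ := ((measure_mono hKb).trans_lt measure_ball_lt_top).ne
  have h1 : μ ((fun x => (1 + ρ) • x) '' K) = ENNReal.ofReal ((1 + ρ) ^ d) * μ K := by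
    have := Measure.addHaar_smul μ (1 + ρ) K
    rw [hdim, abs_of_pos (by positivity)] at this
    exact this
  have hsub : ((fun x => (1 + ρ) • x) '' K) ⊆ K ∪ closedBall (w : EuclideanSpace ℝ (Fin d)) (2 * ρ) := by
    rintro _ ⟨_, ⟨t, ht, _, ⟨x, hx, rfl⟩, rfl⟩, rfl⟩
    have hxn : ‖(x : EuclideanSpace ℝ (Fin d))‖ = 1 := by simp
    by_cases h : (1 + ρ) * t < 1
    · left
      exact ⟨(1 + ρ) * t, ⟨mul_pos (by positivity) ht.1, h⟩, x, ⟨x, hx, rfl⟩, by simp [smul_smul]⟩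
    · right
      rw [mem_closedBall, dist_eq_norm]
      have hx' : ‖(x : EuclideanSpace ℝ (Fin d)) - w‖ ≤ ρ := by
        rw [← dist_eq_norm]; exact hx
      have e : (1 + ρ) • t • (x : EuclideanSpace ℝ (Fin d)) - w
          = ((1 + ρ) * t - 1) • (x : EuclideanSpace ℝ (Fin d)) + (x - w) := by
        rw [sub_smul, mul_smul]; simp
      change ‖(1 + ρ) • t • (x : EuclideanSpace ℝ (Fin d)) - w‖ ≤ _
      rw [e]
      refine (norm_add_le _ _).trans ?_
      rw [norm_smul, hxn, Real.norm_eq_abs, abs_of_nonneg (by linarith)]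
      have : (1 + ρ) * t ≤ 1 + ρ := by nlinarith [ht.2]
      linarith
  have h2 := (measure_mono hsub).trans (measure_union_le (μ := μ) _ _)
  rw [h1, Measure.addHaar_closedBall μ _ (by positivity), hdim] at h2
  have e1 : μ K = ENNReal.ofReal (μ.real K) := (ofReal_measureReal hKfin).symm
  have e2 : μ (ball 0 1) = ENNReal.ofReal V := (ofReal_measureReal measure_ball_lt_top.ne).symm
  have hk0 : 0 ≤ μ.real K := measureReal_nonneg
  have hV0 : 0 ≤ V := measureReal_nonneg
  rw [e1, e2, ← ENNReal.ofReal_mul (by positivity), ← ENNReal.ofReal_mul (by positivity),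
    ← ENNReal.ofReal_add hk0 (by positivity), ENNReal.ofReal_le_ofReal_iff (by positivity)] at h2
  rw [e1, ← ENNReal.ofReal_natCast, ← ENNReal.ofReal_mul (by positivity)]
  apply ENNReal.ofReal_le_ofReal
  have hb := one_add_mul_le_pow (a := ρ) (by linarith) d
  have h3 : d * ρ * μ.real K ≤ (2 * ρ) ^ d * V := by nlinarith
  have h4 : (2 * ρ) ^ d = ρ * (2 ^ d * ρ ^ (d - 1)) := by
    rw [mul_pow]; obtain ⟨e, rfl⟩ : ∃ e, d = e + 1 := ⟨d - 1, by omega⟩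
    simp [pow_succ]; ring
  rw [h4] at h3
  refine le_of_mul_le_mul_left ?_ hρ
  linarith

lemma rpow_gap (p : ℝ) (hp : 0 < p) (n m M : ℕ) (hn : 1 ≤ n) (hnm : n ≤ m) (hm : m ≤ M) :
    ((m : ℝ) - n) * (p * (M : ℝ) ^ (-p - 1)) ≤ (n : ℝ) ^ (-p) - (m : ℝ) ^ (-p) := by
  have hn0 : (0 : ℝ) < n := by exact_mod_cast hn
  have hnm' : (n : ℝ) ≤ m := by exact_mod_cast hnm
  have hmM : (m : ℝ) ≤ M := by exact_mod_cast hm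
  have key := (convex_Icc (n : ℝ) m).image_sub_le_mul_sub_of_deriv_le (f := fun x : ℝ => x ^ (-p))
    (C := -(p * (M : ℝ) ^ (-p - 1))) ?_ ?_ ?_ n ⟨le_rfl, hnm'⟩ m ⟨hnm', le_rfl⟩ hnm'
  · nlinarith
  · intro x hx
    exact (Real.continuousAt_rpow_const x _ (Or.inl (by linarith [hx.1]))).continuousWithinAt
  · intro x hx
    rw [interior_Icc] at hx
    exact (Real.differentiableAt_rpow_const_of_ne _ (by linarith [hx.1])).differentiableWithinAt
  · intro x hx
    rw [interior_Icc] at hx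
    have hx0 : 0 < x := by linarith [hx.1]
    rw [Real.deriv_rpow_const]
    have : (M : ℝ) ^ (-p - 1) ≤ x ^ (-p - 1) :=
      Real.rpow_le_rpow_of_nonpos hx0 (by linarith [hx.2]) (by linarith)
    nlinarith

lemma card_le_of_spread (H : Finset ℕ) (B : ℝ) (hB : 0 ≤ B)
    (h : ∀ n ∈ H, ∀ m ∈ H, n ≤ m → (m : ℝ) - n ≤ B) : (H.card : ℝ) ≤ 1 + B := by
  rcases H.eq_empty_or_nonempty with rfl | hne
  · simp; linarith
  · have h1 := h _ (H.min'_mem hne) _ (H.max'_mem hne) (H.min'_le _ (H.max'_mem hne))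
    have h2 : H ⊆ Finset.Icc (H.min' hne) (H.max' hne) := fun x hx =>
      Finset.mem_Icc.2 ⟨H.min'_le _ hx, H.le_max' _ hx⟩
    have h3 := Finset.card_le_card h2
    rw [Nat.card_Icc] at h3
    have h5 := H.min'_le _ (H.max'_mem hne)
    have h4 : H.card + H.min' hne ≤ H.max' hne + 1 := by omega
    have h4' : (H.card : ℝ) + H.min' hne ≤ H.max' hne + 1 := by exact_mod_cast h4
    linarith

open MeasureTheory in
lemma sum_sphere (d : ℕ) (hd : 2 ≤ d) (p : ℝ) (hp : 0 < p) (N : ℕ) (hN : 1 ≤ N)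
    (U : Set (EuclideanSpace ℝ (Fin d))) (hU : Bornology.IsBounded U) (hu : 0 < diam U) :
    ∑ n ∈ Finset.Ico N (2 * N),
      (volume : Measure (EuclideanSpace ℝ (Fin d))).toSphere
        {w | ((n : ℝ) ^ (-p)) • (w : EuclideanSpace ℝ (Fin d)) ∈ U} ≤
    ENNReal.ofReal ((1 + diam U * (2 * N) ^ (p + 1) / p) *
      (2 ^ d * (diam U * (2 * N) ^ p) ^ (d - 1) *
        (volume : Measure (EuclideanSpace ℝ (Fin d))).real (ball 0 1))) := by
  classical
  set μ : Measure (EuclideanSpace ℝ (Fin d)) := volume with hμ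
  set V := μ.real (ball 0 1) with hV
  have hV0 : 0 ≤ V := measureReal_nonneg
  set A : ℕ → Set (sphere (0 : EuclideanSpace ℝ (Fin d)) 1) :=
    fun n => {w | ((n : ℝ) ^ (-p)) • (w : EuclideanSpace ℝ (Fin d)) ∈ U} with hA
  change ∑ n ∈ Finset.Ico N (2 * N), μ.toSphere (A n) ≤ _
  set u := diam U
  have hN0 : (0 : ℝ) < N := by exact_mod_cast hN
  set H := (Finset.Ico N (2 * N)).filter (fun n => (A n).Nonempty) with hH
  have e : ∑ n ∈ Finset.Ico N (2 * N), μ.toSphere (A n) = ∑ n ∈ H, μ.toSphere (A n) := by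
    rw [hH, Finset.sum_filter]
    refine Finset.sum_congr rfl fun n _ => ?_
    split_ifs with h
    · rfl
    · rw [not_nonempty_iff_eq_empty.1 h]; simp
  have hb : ∀ n ∈ H, μ.toSphere (A n) ≤
      ENNReal.ofReal (2 ^ d * (u * (2 * N) ^ p) ^ (d - 1) * V) := by
    intro n hn
    obtain ⟨hn1, w, hw⟩ := Finset.mem_filter.1 hn
    rw [Finset.mem_Ico] at hn1
    have hn0 : (0 : ℝ) < n := lt_of_lt_of_le hN0 (by exact_mod_cast hn1.1)
    have hn2 : (n : ℝ) ≤ 2 * N := by exact_mod_cast hn1.2.le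
    refine (measure_mono ?_).trans (cap_bound d hd w _ (by positivity))
    intro x hx
    have h1 := dist_le_diam_of_mem hU hx hw
    rw [dist_eq_norm, ← smul_sub, norm_smul, Real.norm_eq_abs, abs_of_pos (by positivity)] at h1
    rw [mem_closedBall, Subtype.dist_eq, dist_eq_norm]
    rw [Real.rpow_neg hn0.le, inv_mul_le_iff₀ (by positivity)] at h1
    refine h1.trans ?_
    rw [mul_comm]
    gcongr
  have hc : (H.card : ℝ) ≤ 1 + u * (2 * N) ^ (p + 1) / p := by
    apply card_le_of_spread _ _ (by positivity)
    intro n hn m hm hnm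
    obtain ⟨hn1, w, hw⟩ := Finset.mem_filter.1 hn
    obtain ⟨hm1, z, hz⟩ := Finset.mem_filter.1 hm
    rw [Finset.mem_Ico] at hn1 hm1
    have h1 := rpow_gap p hp n m (2 * N) (by omega) hnm hm1.2.le
    have h2 := dist_le_diam_of_mem hU hw hz
    have h3 : (n : ℝ) ^ (-p) - (m : ℝ) ^ (-p) ≤ u := by
      refine le_trans ?_ h2
      rw [dist_eq_norm]
      refine le_trans ?_ (norm_sub_norm_le _ _)
      rw [norm_smul, norm_smul]
      simp [abs_of_nonneg, Real.rpow_nonneg]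
    have h4 := h1.trans h3
    have h5 : ((2 * N : ℕ) : ℝ) ^ (-p - 1) = ((2 * N : ℝ) ^ (p + 1))⁻¹ := by
      rw [← Real.rpow_neg (by positivity)]; push_cast; congr 1; ring
    rw [h5] at h4
    have hq : (0 : ℝ) < (2 * N) ^ (p + 1) := by positivity
    rw [le_div_iff₀ hp]
    rw [← mul_assoc, mul_inv_le_iff₀ hq] at h4
    exact h4
  rw [e]
  refine (Finset.sum_le_card_nsmul _ _ _ hb).trans ?_
  rw [nsmul_eq_mul, ← ENNReal.ofReal_natCast, ← ENNReal.ofReal_mul (by positivity)]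
  apply ENNReal.ofReal_le_ofReal
  gcongr

lemma calc_lower (d : ℕ) (hd : 2 ≤ d) (p θ Q a s u δ V : ℝ) (N : ℕ) (hp : 0 < p) (hθ : 0 < θ)
    (hQ : Q = 1 - p * ((d : ℝ) - 1)) (hQ0 : 0 < Q) (ha : 0 < a)
    (hs : s = (d : ℝ) - 1 + a * Q) (hs' : θ * (d - s) = a * p * d) (hδ : 0 < δ)
    (hu : δ ≤ u) (hu' : u ≤ δ ^ θ) (hN1 : δ ^ (-a) ≤ N) (hN2 : (N : ℝ) ≤ 2 * δ ^ (-a))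
    (hV : 0 ≤ V) :
    (1 + u * (2 * N) ^ (p + 1) / p) * (2 ^ d * (u * (2 * N) ^ p) ^ (d - 1) * V) ≤
      N * ((2 * (1 + 4 ^ (p * d) / p) * 2 ^ d * V) * u ^ s) := by
  have hd0 : (0 : ℝ) < d := by positivity
  have hu0 : 0 < u := hδ.trans_le hu
  have hNp : (0 : ℝ) < N := lt_of_lt_of_le (by positivity) hN1
  have hd1 : ((d - 1 : ℕ) : ℝ) = (d : ℝ) - 1 := by
    rw [Nat.cast_sub (by omega)]; simp
  have hd2 : (0 : ℝ) < (d : ℝ) - 1 := by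
    have : (2 : ℝ) ≤ d := by exact_mod_cast hd
    linarith
  set M : ℝ := 2 * N with hM
  have hM0 : 0 < M := by positivity
  have e1 : (u * M ^ p) ^ (d - 1) = u ^ ((d : ℝ) - 1) * M ^ (p * ((d : ℝ) - 1)) := by
    rw [mul_pow, ← Real.rpow_natCast u, ← Real.rpow_natCast (M ^ p), ← Real.rpow_mul hM0.le, hd1]
  have f1 : u ^ ((d : ℝ) - 1) * M ^ (p * ((d : ℝ) - 1)) ≤ M * u ^ s := by
    have g1 : M ^ (p * ((d : ℝ) - 1)) = M * M ^ (-Q) := by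
      rw [← Real.rpow_one_add' hM0.le (by
        have : 0 < p * ((d : ℝ) - 1) := mul_pos hp hd2
        rw [hQ]; intro h; linarith)]
      congr 1; rw [hQ]; ring
    have g2 : M ^ (-Q) ≤ u ^ (a * Q) := by
      calc M ^ (-Q) ≤ (δ ^ (-a)) ^ (-Q) :=
            Real.rpow_le_rpow_of_nonpos (by positivity) (by linarith) (by linarith)
        _ = δ ^ (a * Q) := by rw [← Real.rpow_mul hδ.le]; congr 1; ring
        _ ≤ u ^ (a * Q) := Real.rpow_le_rpow hδ.le hu (by positivity)
    rw [g1, hs, Real.rpow_add hu0]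
    calc _ = M * (u ^ ((d : ℝ) - 1) * M ^ (-Q)) := by ring
      _ ≤ _ := by gcongr
  have f2 : u * M ^ (p + 1) * (u ^ ((d : ℝ) - 1) * M ^ (p * ((d : ℝ) - 1))) ≤
      M * 4 ^ (p * d) * u ^ s := by
    have g1 : M ^ (p + 1) * M ^ (p * ((d : ℝ) - 1)) = M * M ^ (p * d) := by
      rw [← Real.rpow_add hM0, ← Real.rpow_one_add' hM0.le (by positivity)]
      congr 1; ring
    have g2 : u * u ^ ((d : ℝ) - 1) = u ^ ((d : ℝ) - s) * u ^ s := by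
      rw [← Real.rpow_add hu0, ← Real.rpow_one_add' hu0.le (by ring_nf; positivity)]
      congr 1; ring
    have hds : 0 ≤ (d : ℝ) - s := by
      have : 0 < a * p * d := by positivity
      by_contra h; push Not at h; nlinarith
    have g3 : u ^ ((d : ℝ) - s) ≤ δ ^ (a * p * d) := by
      calc u ^ ((d : ℝ) - s) ≤ (δ ^ θ) ^ ((d : ℝ) - s) := Real.rpow_le_rpow hu0.le hu' hds
        _ = δ ^ (a * p * d) := by rw [← Real.rpow_mul hδ.le, hs']
    have g4 : M ^ (p * d) ≤ 4 ^ (p * d) * δ ^ (-(a * p * d)) := by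
      calc M ^ (p * d) ≤ (4 * δ ^ (-a)) ^ (p * d) :=
            Real.rpow_le_rpow hM0.le (by linarith) (by positivity)
        _ = _ := by
            rw [Real.mul_rpow (by norm_num) (by positivity), ← Real.rpow_mul hδ.le]
            congr 2; ring
    have g5 : δ ^ (-(a * p * d)) * δ ^ (a * p * d) = 1 := by
      rw [← Real.rpow_add hδ]; simp
    calc _ = (u * u ^ ((d : ℝ) - 1)) * (M ^ (p + 1) * M ^ (p * ((d : ℝ) - 1))) := by ring
      _ = M * (M ^ (p * d) * u ^ ((d : ℝ) - s)) * u ^ s := by rw [g1, g2]; ring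
      _ ≤ M * ((4 ^ (p * d) * δ ^ (-(a * p * d))) * δ ^ (a * p * d)) * u ^ s := by gcongr
      _ = _ := by rw [mul_assoc (4 ^ (p * d) : ℝ), g5]; ring
  rw [e1]
  set X := u ^ ((d : ℝ) - 1) * M ^ (p * ((d : ℝ) - 1))
  calc (1 + u * M ^ (p + 1) / p) * (2 ^ d * X * V)
      = 2 ^ d * V * (X + (u * M ^ (p + 1) * X) / p) := by field_simp
    _ ≤ 2 ^ d * V * (M * u ^ s + (M * 4 ^ (p * d) * u ^ s) / p) := by gcongr
    _ = _ := by rw [hM]; ring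

lemma exists_N (δ a : ℝ) (hδ : 0 < δ) (hδ1 : δ < 1) (ha : 0 < a) :
    ∃ N : ℕ, 1 ≤ N ∧ δ ^ (-a) ≤ N ∧ (N : ℝ) ≤ 2 * δ ^ (-a) := by
  have h1 : 1 ≤ δ ^ (-a) := Real.one_le_rpow_of_pos_of_le_one_of_nonpos hδ hδ1.le (by linarith)
  refine ⟨⌈δ ^ (-a)⌉₊, Nat.one_le_ceil_iff.2 (by linarith), Nat.le_ceil _, ?_⟩
  have := Nat.ceil_lt_add_one (a := δ ^ (-a)) (by linarith)
  linarith

open MeasureTheory in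
lemma lower_bound (d : ℕ) (hd : 2 ≤ d) (p θ Q a s : ℝ) (hp : 0 < p) (hθ : 0 < θ)
    (hQ : Q = 1 - p * ((d : ℝ) - 1)) (hQ0 : 0 < Q) (ha : 0 < a)
    (hs : s = (d : ℝ) - 1 + a * Q) (hs' : θ * (d - s) = a * p * d) :
    ∃ c : ℝ, 0 < c ∧ ∀ δ : ℝ, 0 < δ → δ < 1 →
      ∀ 𝒰 : Set (Set (EuclideanSpace ℝ (Fin d))), 𝒰.Countable → concentric d p ⊆ ⋃₀ 𝒰 →
      (∀ U ∈ 𝒰, δ ≤ diam U ∧ diam U ≤ δ ^ θ) →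
      ENNReal.ofReal c ≤ ∑' U : 𝒰, ENNReal.ofReal
        (diam (U : Set (EuclideanSpace ℝ (Fin d))) ^ s) := by
  have : NeZero d := ⟨by omega⟩
  set μ : Measure (EuclideanSpace ℝ (Fin d)) := volume with hμ
  set V := μ.real (ball 0 1) with hV
  have e2 : μ (ball 0 1) = ENNReal.ofReal V := (ofReal_measureReal measure_ball_lt_top.ne).symm
  have hV0 : 0 < V := by
    have : 0 < μ (ball 0 1) := measure_ball_pos _ _ one_pos
    rw [e2] at this
    exact ENNReal.ofReal_pos.1 this
  set C := 2 * (1 + 4 ^ (p * d) / p) * 2 ^ d * V with hC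
  have hC0 : 0 < C := by positivity
  have hd0 : (0 : ℝ) < d := by positivity
  refine ⟨d * V / C, by positivity, fun δ hδ hδ1 𝒰 hc hcov hdiam => ?_⟩
  obtain ⟨N, hN, hN1, hN2⟩ := exists_N δ a hδ hδ1 ha
  have hN0 : (0 : ℝ) < N := by exact_mod_cast hN
  have : Countable 𝒰 := hc.to_subtype
  have hdim : Module.finrank ℝ (EuclideanSpace ℝ (Fin d)) = d := by simp
  have hun : μ.toSphere univ = ENNReal.ofReal (d * V) := by
    rw [Measure.toSphere_apply_univ, hdim, e2, ENNReal.ofReal_mul (by positivity),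
      ENNReal.ofReal_natCast]
  have h1 : ∀ n ∈ Finset.Ico N (2 * N), ENNReal.ofReal (d * V) ≤ ∑' U : 𝒰, μ.toSphere
      {w | ((n : ℝ) ^ (-p)) • (w : EuclideanSpace ℝ (Fin d)) ∈ (U : Set _)} := by
    intro n hn
    rw [← hun]
    refine (measure_mono ?_).trans (measure_iUnion_le _)
    intro w _
    have hw : ((n : ℝ) ^ (-p)) • (w : EuclideanSpace ℝ (Fin d)) ∈ concentric d p := by
      refine ⟨n, by have := (Finset.mem_Ico.1 hn).1; omega, ?_⟩
      rw [norm_smul]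
      simp [abs_of_nonneg, Real.rpow_nonneg]
    obtain ⟨U, hU, hwU⟩ := hcov hw
    exact mem_iUnion.2 ⟨⟨U, hU⟩, hwU⟩
  have h2 := Finset.sum_le_sum h1
  rw [Finset.sum_const, Nat.card_Ico, show 2 * N - N = N by omega, nsmul_eq_mul,
    ← Summable.tsum_finsetSum (fun _ _ => ENNReal.summable)] at h2
  have h3 : ∀ U : 𝒰, ∑ n ∈ Finset.Ico N (2 * N), μ.toSphere
      {w | ((n : ℝ) ^ (-p)) • (w : EuclideanSpace ℝ (Fin d)) ∈ (U : Set _)} ≤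
      ENNReal.ofReal (N * C) *
        ENNReal.ofReal (diam (U : Set (EuclideanSpace ℝ (Fin d))) ^ s) := by
    rintro ⟨U, hU⟩
    obtain ⟨hu, hu'⟩ := hdiam U hU
    have hu0 : 0 < diam U := hδ.trans_le hu
    have hb : Bornology.IsBounded U := by
      by_contra h
      rw [diam_eq_zero_of_unbounded h] at hu0
      exact lt_irrefl _ hu0
    refine (sum_sphere d hd p hp N hN U hb hu0).trans ?_
    rw [← ENNReal.ofReal_mul (by positivity)]
    apply ENNReal.ofReal_le_ofReal
    refine (calc_lower d hd p θ Q a s _ δ V N hp hθ hQ hQ0 ha hs hs' hδ hu hu' hN1 hN2 hV0.le).trans ?_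
    exact le_of_eq (by rw [hC]; ring)
  have h4 := h2.trans (ENNReal.tsum_le_tsum h3)
  rw [ENNReal.tsum_mul_left, ← ENNReal.ofReal_natCast, ← ENNReal.ofReal_mul (by positivity)] at h4
  have h5 : ENNReal.ofReal (N * (d * V)) = ENNReal.ofReal (N * C) * ENNReal.ofReal (d * V / C) := by
    rw [← ENNReal.ofReal_mul (by positivity)]
    congr 1; field_simp
  rw [h5] at h4
  exact (ENNReal.mul_le_mul_iff_right (ENNReal.ofReal_pos.2 (by positivity)).ne' ENNReal.ofReal_ne_top).1 h4

open MeasureTheory in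
lemma pack (d : ℕ) (hd : 2 ≤ d) (A W : Set (EuclideanSpace ℝ (Fin d))) (h M : ℝ) (hh : 0 < h)
    (hM : 0 ≤ M) (hAW : ∀ x ∈ A, ball x h ⊆ W) (hW : volume W ≤ ENNReal.ofReal M) :
    ∃ P : Finset (EuclideanSpace ℝ (Fin d)), (A ⊆ ⋃ x ∈ P, closedBall x (2 * h)) ∧
      (P.card : ℝ) * (h ^ d * (volume : Measure (EuclideanSpace ℝ (Fin d))).real (ball 0 1)) ≤ M := by
  have : NeZero d := ⟨by omega⟩
  set μ : Measure (EuclideanSpace ℝ (Fin d)) := volume with hμ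
  set V := μ.real (ball 0 1) with hV
  have e2 : μ (ball 0 1) = ENNReal.ofReal V := (ofReal_measureReal measure_ball_lt_top.ne).symm
  have hV0 : 0 < V := by
    have : 0 < μ (ball 0 1) := measure_ball_pos _ _ one_pos
    rw [e2] at this
    exact ENNReal.ofReal_pos.1 this
  have hdim : Module.finrank ℝ (EuclideanSpace ℝ (Fin d)) = d := by simp
  have key : ∀ P : Finset (EuclideanSpace ℝ (Fin d)), (P : Set _) ⊆ A →
      (∀ x ∈ P, ∀ y ∈ P, x ≠ y → 2 * h < dist x y) → (P.card : ℝ) * (h ^ d * V) ≤ M := by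
    intro P hPA hP
    have h1 : μ (⋃ x ∈ P, ball x h) = ∑ x ∈ P, μ (ball x h) := by
      apply measure_biUnion_finset
      · intro x hx y hy hxy
        exact ball_disjoint_ball (by linarith [hP x hx y hy hxy])
      · intro x _; exact isOpen_ball.measurableSet
    have h2 : μ (⋃ x ∈ P, ball x h) ≤ ENNReal.ofReal M :=
      (measure_mono (iUnion₂_subset fun x hx => hAW x (hPA hx))).trans hW
    rw [h1] at h2
    simp only [Measure.addHaar_ball μ _ hh.le, hdim] at h2
    rw [Finset.sum_const, nsmul_eq_mul, e2, ← ENNReal.ofReal_mul (by positivity),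
      ← ENNReal.ofReal_natCast, ← ENNReal.ofReal_mul (by positivity),
      ENNReal.ofReal_le_ofReal_iff hM] at h2
    exact h2
  classical
  let S : Set ℕ := {k | ∃ P : Finset (EuclideanSpace ℝ (Fin d)), (P : Set _) ⊆ A ∧
      (∀ x ∈ P, ∀ y ∈ P, x ≠ y → 2 * h < dist x y) ∧ P.card = k}
  have hS0 : S.Nonempty := ⟨0, ∅, by simp, by simp, by simp⟩
  have hSb : BddAbove S := by
    refine ⟨⌈M / (h ^ d * V)⌉₊, ?_⟩
    rintro k ⟨P, h1, h2, rfl⟩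
    have h3 := key P h1 h2
    have : (P.card : ℝ) ≤ ⌈M / (h ^ d * V)⌉₊ := by
      refine le_trans ?_ (Nat.le_ceil _)
      rw [le_div_iff₀ (by positivity)]; exact h3
    exact_mod_cast this
  obtain ⟨P, h1, h2, h3⟩ := Nat.sSup_mem hS0 hSb
  refine ⟨P, ?_, key P h1 h2⟩
  intro x hx
  by_contra hcon
  simp only [mem_iUnion, mem_closedBall, not_exists, not_le] at hcon
  have hxP : x ∉ P := fun hm => by
    have := hcon x hm
    rw [dist_self] at this
    linarith
  have hmem : (insert x P).card ∈ S := by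
    refine ⟨insert x P, ?_, ?_, rfl⟩
    · rw [Finset.coe_insert]; exact insert_subset hx h1
    · intro y hy z hz hyz
      rcases Finset.mem_insert.1 hy with rfl | hy' <;> rcases Finset.mem_insert.1 hz with rfl | hz'
      · exact absurd rfl hyz
      · exact hcon z hz'
      · rw [dist_comm]; exact hcon y hy'
      · exact h2 y hy' z hz' hyz
  have := le_csSup hSb hmem
  rw [Finset.card_insert_of_notMem hxP, ← h3] at this
  omega

lemma sum_rpow_le (Q : ℝ) (hQ0 : 0 < Q) (hQ1 : Q ≤ 1) (N : ℕ) :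
    ∑ n ∈ Finset.Icc 1 N, (n : ℝ) ^ (Q - 1) ≤ (N : ℝ) ^ Q / Q := by
  induction N with
  | zero => simp [Real.zero_rpow hQ0.ne']
  | succ N ih =>
    rw [Finset.sum_Icc_succ_top (by omega)]
    refine (add_le_add_left ih _).trans ?_
    have hN : (0 : ℝ) < (N : ℝ) + 1 := by positivity
    push_cast
    have h1 := rpow_one_add_le_one_add_mul_self (s := -(1 / ((N : ℝ) + 1))) (p := Q)
      (by rw [neg_le_neg_iff, div_le_one hN]; linarith [N.cast_nonneg (α := ℝ)]) hQ0.le hQ1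
    have h2 : (1 + -(1 / ((N : ℝ) + 1))) = N / (N + 1) := by field_simp; ring
    rw [h2, Real.div_rpow (by positivity) hN.le, div_le_iff₀ (by positivity)] at h1
    rw [Real.rpow_sub_one hN.ne', ← sub_nonneg]
    have h3 : ((N : ℝ) + 1) ^ Q / Q - (N ^ Q / Q + (N + 1) ^ Q / (N + 1)) =
      ((1 + Q * -(1 / ((N : ℝ) + 1))) * (N + 1) ^ Q - N ^ Q) / Q := by field_simp; ring
    rw [h3]
    exact div_nonneg (by linarith) hQ0.le

open MeasureTheory in
lemma shell_vol (d : ℕ) (hd : 2 ≤ d) (R h : ℝ) (hh : 0 < h) (hR : h ≤ R) :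
    volume (ball (0 : EuclideanSpace ℝ (Fin d)) (R + h) \ closedBall 0 (R - h)) ≤
    ENNReal.ofReal ((volume : Measure (EuclideanSpace ℝ (Fin d))).real (ball 0 1) *
      (d * 2 ^ d * h * R ^ (d - 1))) := by
  have : NeZero d := ⟨by omega⟩
  set μ : Measure (EuclideanSpace ℝ (Fin d)) := volume with hμ
  set V := μ.real (ball 0 1) with hV
  have e2 : μ (ball 0 1) = ENNReal.ofReal V := (ofReal_measureReal measure_ball_lt_top.ne).symm
  have hV0 : 0 ≤ V := measureReal_nonneg
  have hdim : Module.finrank ℝ (EuclideanSpace ℝ (Fin d)) = d := by simp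
  rw [measure_sdiff (closedBall_subset_ball (by linarith)) isClosed_closedBall.nullMeasurableSet
    measure_closedBall_lt_top.ne, Measure.addHaar_ball μ _ (by linarith),
    Measure.addHaar_closedBall μ _ (by linarith), hdim, e2,
    ← ENNReal.ofReal_mul (pow_nonneg (by linarith) _),
    ← ENNReal.ofReal_mul (pow_nonneg (by linarith) _),
    ← ENNReal.ofReal_sub _ (mul_nonneg (pow_nonneg (by linarith) _) hV0)]
  apply ENNReal.ofReal_le_ofReal
  rw [← sub_mul, mul_comm]
  refine mul_le_mul_of_nonneg_left ?_ hV0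
  have hX : 0 < R + h := by linarith
  have hb := one_add_mul_le_pow (a := -(2 * h / (R + h)))
    (by rw [neg_le_neg_iff, div_le_iff₀ hX]; linarith) d
  have h2 : 1 + -(2 * h / (R + h)) = (R - h) / (R + h) := by field_simp; ring
  rw [h2, div_pow, le_div_iff₀ (by positivity)] at hb
  obtain ⟨e, rfl⟩ : ∃ e, d = e + 1 := ⟨d - 1, by omega⟩
  have h3 : (1 + ((e + 1 : ℕ) : ℝ) * -(2 * h / (R + h))) * (R + h) ^ (e + 1) =
      (R + h) ^ (e + 1) - ((e + 1 : ℕ) : ℝ) * (2 * h) * (R + h) ^ e := by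
    rw [pow_succ]; field_simp; ring
  rw [h3] at hb
  have h4 : (R + h) ^ e ≤ (2 * R) ^ e := pow_le_pow_left₀ hX.le (by linarith) _
  rw [mul_pow] at h4
  calc _ ≤ ((e + 1 : ℕ) : ℝ) * (2 * h) * (R + h) ^ e := by linarith
    _ ≤ ((e + 1 : ℕ) : ℝ) * (2 * h) * (2 ^ e * R ^ e) := by gcongr
    _ = _ := by simp [pow_succ]; ring

open MeasureTheory in
lemma cover_outer (d : ℕ) (hd : 2 ≤ d) (p Q h : ℝ) (N : ℕ)
    (hQ : Q = 1 - p * ((d : ℝ) - 1)) (hQ0 : 0 < Q) (hQ1 : Q ≤ 1) (hh : 0 < h)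
    (hR : ∀ n : ℕ, 1 ≤ n → n ≤ N → h ≤ (n : ℝ) ^ (-p)) :
    ∃ P : Finset (EuclideanSpace ℝ (Fin d)),
      ({x | ∃ n : ℕ, 1 ≤ n ∧ n ≤ N ∧ ‖x‖ = (n : ℝ) ^ (-p)} ⊆ ⋃ x ∈ P, closedBall x (2 * h)) ∧
      (P.card : ℝ) * h ^ (d - 1) ≤ d * 2 ^ d / Q * (N : ℝ) ^ Q := by
  have : NeZero d := ⟨by omega⟩
  set μ : Measure (EuclideanSpace ℝ (Fin d)) := volume with hμ
  set V := μ.real (ball 0 1) with hV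
  have hV0 : 0 < V := by
    have : 0 < μ (ball 0 1) := measure_ball_pos _ _ one_pos
    exact ENNReal.toReal_pos this.ne' measure_ball_lt_top.ne
  have hd1 : ((d - 1 : ℕ) : ℝ) = (d : ℝ) - 1 := by
    rw [Nat.cast_sub (by omega)]; simp
  have hpk := pack d hd {x | ∃ n : ℕ, 1 ≤ n ∧ n ≤ N ∧ ‖x‖ = (n : ℝ) ^ (-p)}
    (⋃ n ∈ Finset.Icc 1 N, ball (0 : EuclideanSpace ℝ (Fin d)) ((n : ℝ) ^ (-p) + h) \
      closedBall 0 ((n : ℝ) ^ (-p) - h)) h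
    (∑ n ∈ Finset.Icc 1 N, V * (d * 2 ^ d * h * ((n : ℝ) ^ (-p)) ^ (d - 1))) hh
    (Finset.sum_nonneg fun _ _ => by positivity) ?_ ?_
  · obtain ⟨P, h1, h2⟩ := hpk
    refine ⟨P, h1, ?_⟩
    have h3 : ∑ n ∈ Finset.Icc 1 N, V * (d * 2 ^ d * h * ((n : ℝ) ^ (-p)) ^ (d - 1)) =
        V * (d * 2 ^ d * h) * ∑ n ∈ Finset.Icc 1 N, (n : ℝ) ^ (Q - 1) := by
      rw [Finset.mul_sum]
      refine Finset.sum_congr rfl fun n _ => ?_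
      rw [← Real.rpow_natCast ((n : ℝ) ^ (-p)), ← Real.rpow_mul (by positivity), hd1, hQ,
        show -p * ((d : ℝ) - 1) = 1 - p * ((d : ℝ) - 1) - 1 by ring]
      ring
    have h4 := sum_rpow_le Q hQ0 hQ1 N
    have h5 : (P.card : ℝ) * (h ^ d * V) ≤ V * (d * 2 ^ d * h) * ((N : ℝ) ^ Q / Q) := by
      refine h2.trans (h3.le.trans ?_)
      gcongr
    have h6 : h ^ d = h ^ (d - 1) * h := by
      rw [← pow_succ]; congr 1; omega
    rw [h6] at h5
    refine le_of_mul_le_mul_left ?_ (mul_pos hV0 hh)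
    calc _ = (P.card : ℝ) * (h ^ (d - 1) * h * V) := by ring
      _ ≤ _ := h5
      _ = _ := by ring
  · rintro x ⟨n, hn1, hn2, hx⟩ y hy
    rw [mem_ball, dist_eq_norm] at hy
    refine mem_iUnion₂.2 ⟨n, Finset.mem_Icc.2 ⟨hn1, hn2⟩, ?_, ?_⟩
    · rw [mem_ball_zero_iff]
      have := norm_sub_norm_le y x
      linarith
    · rw [mem_closedBall_zero_iff, not_le]
      have := norm_sub_norm_le x y
      rw [norm_sub_rev] at this
      linarith
  · refine (measure_biUnion_finset_le _ _).trans ?_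
    rw [ENNReal.ofReal_sum_of_nonneg fun _ _ => by positivity]
    refine Finset.sum_le_sum fun n hn => ?_
    obtain ⟨hn1, hn2⟩ := Finset.mem_Icc.1 hn
    exact shell_vol d hd _ h hh (hR n hn1 hn2)

open MeasureTheory in
lemma cover_inner (d : ℕ) (hd : 2 ≤ d) (R h : ℝ) (hh : 0 < h) (hR : h ≤ R) :
    ∃ P : Finset (EuclideanSpace ℝ (Fin d)),
      (closedBall (0 : EuclideanSpace ℝ (Fin d)) R ⊆ ⋃ x ∈ P, closedBall x (2 * h)) ∧
      (P.card : ℝ) * h ^ d ≤ (2 * R) ^ d := by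
  have : NeZero d := ⟨by omega⟩
  set μ : Measure (EuclideanSpace ℝ (Fin d)) := volume with hμ
  set V := μ.real (ball 0 1) with hV
  have e2 : μ (ball 0 1) = ENNReal.ofReal V := (ofReal_measureReal measure_ball_lt_top.ne).symm
  have hV0 : 0 < V := by
    have : 0 < μ (ball 0 1) := measure_ball_pos _ _ one_pos
    exact ENNReal.toReal_pos this.ne' measure_ball_lt_top.ne
  have hdim : Module.finrank ℝ (EuclideanSpace ℝ (Fin d)) = d := by simp
  have hR0 : 0 < R := by linarith
  have hpk := pack d hd (closedBall 0 R) (ball 0 (2 * R)) h ((2 * R) ^ d * V) hh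
    (by positivity) ?_ ?_
  · obtain ⟨P, h1, h2⟩ := hpk
    refine ⟨P, h1, le_of_mul_le_mul_right ?_ hV0⟩
    calc _ = (P.card : ℝ) * (h ^ d * V) := by ring
      _ ≤ _ := h2
  · intro x hx
    rw [mem_closedBall_zero_iff] at hx
    apply ball_subset_ball'
    rw [dist_zero_right]; linarith
  · rw [Measure.addHaar_ball μ _ (by positivity), hdim, e2, ← ENNReal.ofReal_mul (by positivity)]

lemma upper_bound (d : ℕ) (hd : 2 ≤ d) (p θ Q a s : ℝ) (hp : 0 < p) (hp1 : p ≤ 1) (hθ : 0 < θ)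
    (hθ' : θ ≤ 1)
    (hQ : Q = 1 - p * ((d : ℝ) - 1)) (hQ0 : 0 < Q) (ha : 0 < a) (hap : a * p ≤ θ)
    (hs : s = (d : ℝ) - 1 + a * Q) (hs' : θ * (d - s) = a * p * d) :
    ∃ C : ℝ, 0 < C ∧ ∀ δ : ℝ, 0 < δ → δ < 1 → ∀ t : ℝ, s ≤ t →
      ∃ 𝒰 : Set (Set (EuclideanSpace ℝ (Fin d))), 𝒰.Countable ∧ concentric d p ⊆ ⋃₀ 𝒰 ∧
      (∀ U ∈ 𝒰, δ ≤ diam U ∧ diam U ≤ δ ^ θ) ∧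
      ∑' U : 𝒰, ENNReal.ofReal (diam (U : Set (EuclideanSpace ℝ (Fin d))) ^ t) ≤
        ENNReal.ofReal (C * δ ^ (θ * (t - s))) := by
  classical
  have : NeZero d := ⟨by omega⟩
  have hd1 : ((d - 1 : ℕ) : ℝ) = (d : ℝ) - 1 := by
    rw [Nat.cast_sub (by omega)]; simp
  have hd2 : (0 : ℝ) < (d : ℝ) - 1 := by
    have : (2 : ℝ) ≤ d := by exact_mod_cast hd
    linarith
  have hQ1 : Q ≤ 1 := by
    have : 0 < p * ((d : ℝ) - 1) := mul_pos hp hd2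
    linarith
  set C1 : ℝ := d * 2 ^ d / Q * 2 * 4 ^ (d - 1) with hC1
  have hC10 : 0 < C1 := by positivity
  refine ⟨C1 + 8 ^ d, by positivity, fun δ hδ hδ1 t ht => ?_⟩
  obtain ⟨N, hN, hN1, hN2⟩ := exists_N δ a hδ hδ1 ha
  have hN0 : (0 : ℝ) < N := by exact_mod_cast hN
  set ρ := δ ^ θ with hρ
  have hρ0 : 0 < ρ := by positivity
  have hδρ : δ ≤ ρ := by
    have := Real.rpow_le_rpow_of_exponent_ge hδ hδ1.le hθ'
    rwa [Real.rpow_one] at this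
  have hρR : ρ ≤ δ ^ (a * p) := Real.rpow_le_rpow_of_exponent_ge hδ hδ1.le hap
  have hR : ∀ n : ℕ, 1 ≤ n → n ≤ N → δ / 4 ≤ (n : ℝ) ^ (-p) := by
    intro n hn1 hn2
    have hn0 : (0 : ℝ) < n := by exact_mod_cast hn1
    have h1 : (n : ℝ) ≤ 2 * δ ^ (-a) := le_trans (by exact_mod_cast hn2) hN2
    calc δ / 4 ≤ 2⁻¹ * δ ^ (a * p) := by linarith
      _ ≤ 2 ^ (-p) * δ ^ (a * p) := by
        gcongr
        rw [← Real.rpow_neg_one]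
        exact Real.rpow_le_rpow_of_exponent_le (by norm_num) (by linarith)
      _ = (2 * δ ^ (-a)) ^ (-p) := by
        rw [Real.mul_rpow (by norm_num) (by positivity), ← Real.rpow_mul hδ.le]
        congr 2; ring
      _ ≤ _ := Real.rpow_le_rpow_of_nonpos hn0 h1 (by linarith)
  obtain ⟨P1, hP1, hc1⟩ := cover_outer d hd p Q (δ / 4) N hQ hQ0 hQ1 (by positivity) hR
  obtain ⟨P2, hP2, hc2⟩ := cover_inner d hd (δ ^ (a * p)) (ρ / 4) (by positivity) (by linarith)
  have hdm : ∀ (x : EuclideanSpace ℝ (Fin d)) (r : ℝ), 0 < r →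
      diam (closedBall x (2 * (r / 4))) = r := by
    intro x r hr
    rw [diam_closedBall_eq x (by positivity)]; ring
  set F1 := P1.image (fun x => closedBall x (2 * (δ / 4))) with hF1
  set F2 := P2.image (fun x => closedBall x (2 * (ρ / 4))) with hF2
  have hD1 : ∀ U ∈ F1, diam U = δ := by
    intro U hU
    obtain ⟨x, -, rfl⟩ := Finset.mem_image.1 hU
    exact hdm x δ hδ
  have hD2 : ∀ U ∈ F2, diam U = ρ := by
    intro U hU
    obtain ⟨x, -, rfl⟩ := Finset.mem_image.1 hU
    exact hdm x ρ hρ0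
  refine ⟨((F1 ∪ F2 : Finset (Set (EuclideanSpace ℝ (Fin d)))) : Set _), Finset.countable_toSet _,
    ?_, ?_, ?_⟩
  · rintro x ⟨n, hn, hx⟩
    by_cases hnN : n ≤ N
    · obtain ⟨y, hy, hxy⟩ := mem_iUnion₂.1 (hP1 ⟨n, hn, hnN, hx⟩)
      exact ⟨_, Finset.mem_coe.2 (Finset.mem_union_left _ (Finset.mem_image_of_mem _ hy)), hxy⟩
    · have hx2 : x ∈ closedBall (0 : EuclideanSpace ℝ (Fin d)) (δ ^ (a * p)) := by
        rw [mem_closedBall_zero_iff, hx]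
        have hNn : (N : ℝ) ≤ n := by exact_mod_cast (not_le.1 hnN).le
        calc (n : ℝ) ^ (-p) ≤ (δ ^ (-a)) ^ (-p) :=
              Real.rpow_le_rpow_of_nonpos (by positivity) (hN1.trans hNn) (by linarith)
          _ = _ := by rw [← Real.rpow_mul hδ.le]; congr 1; ring
      obtain ⟨y, hy, hxy⟩ := mem_iUnion₂.1 (hP2 hx2)
      exact ⟨_, Finset.mem_coe.2 (Finset.mem_union_right _ (Finset.mem_image_of_mem _ hy)), hxy⟩
  · intro U hU
    rcases Finset.mem_union.1 (Finset.mem_coe.1 hU) with h | h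
    · rw [hD1 U h]; exact ⟨le_rfl, hδρ⟩
    · rw [hD2 U h]; exact ⟨hδρ, le_rfl⟩
  · rw [Finset.tsum_subtype' (F1 ∪ F2)
      (fun U : Set (EuclideanSpace ℝ (Fin d)) => ENNReal.ofReal (diam U ^ t))]
    have hu : ∑ U ∈ F1 ∪ F2, ENNReal.ofReal (diam U ^ t) ≤
        ∑ U ∈ F1, ENNReal.ofReal (diam U ^ t) + ∑ U ∈ F2, ENNReal.ofReal (diam U ^ t) := by
      rw [← Finset.sum_union_inter]; exact le_self_add
    refine hu.trans ?_
    rw [Finset.sum_congr rfl (fun U hU => by rw [hD1 U hU]),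
      Finset.sum_congr (s₁ := F2) rfl (fun U hU => by rw [hD2 U hU]), Finset.sum_const,
      Finset.sum_const, nsmul_eq_mul, nsmul_eq_mul, ← ENNReal.ofReal_natCast,
      ← ENNReal.ofReal_natCast, ← ENNReal.ofReal_mul (by positivity),
      ← ENNReal.ofReal_mul (by positivity), ← ENNReal.ofReal_add (by positivity) (by positivity)]
    apply ENNReal.ofReal_le_ofReal
    rw [add_mul]
    have k1 : (F1.card : ℝ) ≤ P1.card := by exact_mod_cast Finset.card_image_le
    have k2 : (F2.card : ℝ) ≤ P2.card := by exact_mod_cast Finset.card_image_le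
    refine add_le_add ?_ ?_
    · have m1 : (N : ℝ) ^ Q ≤ 2 * δ ^ (-(a * Q)) := by
        calc (N : ℝ) ^ Q ≤ (2 * δ ^ (-a)) ^ Q := Real.rpow_le_rpow hN0.le hN2 hQ0.le
          _ = 2 ^ Q * δ ^ (-(a * Q)) := by
            rw [Real.mul_rpow (by norm_num) (by positivity), ← Real.rpow_mul hδ.le]
            congr 2; ring
          _ ≤ _ := by
            gcongr
            calc (2 : ℝ) ^ Q ≤ 2 ^ (1 : ℝ) :=
                  Real.rpow_le_rpow_of_exponent_le (by norm_num) hQ1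
              _ = 2 := Real.rpow_one 2
      have m2 : (P1.card : ℝ) * δ ^ (d - 1) ≤ C1 * δ ^ (-(a * Q)) := by
        rw [div_pow, mul_div_assoc', div_le_iff₀ (by positivity)] at hc1
        calc _ ≤ _ := hc1
          _ ≤ d * 2 ^ d / Q * (2 * δ ^ (-(a * Q))) * 4 ^ (d - 1) := by gcongr
          _ = _ := by rw [hC1]; ring
      have m3 : δ ^ t = δ ^ (d - 1) * δ ^ (a * Q) * δ ^ (t - s) := by
        rw [← Real.rpow_natCast, ← Real.rpow_add hδ, ← Real.rpow_add hδ, hd1]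
        congr 1; rw [hs]; ring
      have m4 : δ ^ (-(a * Q)) * δ ^ (a * Q) = 1 := by rw [← Real.rpow_add hδ]; simp
      have m5 : δ ^ (t - s) ≤ δ ^ (θ * (t - s)) :=
        Real.rpow_le_rpow_of_exponent_ge hδ hδ1.le (by nlinarith)
      calc (F1.card : ℝ) * δ ^ t ≤ P1.card * δ ^ t := by gcongr
        _ = (P1.card * δ ^ (d - 1)) * (δ ^ (a * Q) * δ ^ (t - s)) := by rw [m3]; ring
        _ ≤ (C1 * δ ^ (-(a * Q))) * (δ ^ (a * Q) * δ ^ (t - s)) := by gcongr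
        _ = C1 * (δ ^ (-(a * Q)) * δ ^ (a * Q)) * δ ^ (t - s) := by ring
        _ = C1 * δ ^ (t - s) := by rw [m4]; ring
        _ ≤ _ := by gcongr
    · have m2 : (P2.card : ℝ) * ρ ^ d ≤ 8 ^ d * (δ ^ (a * p)) ^ d := by
        rw [div_pow, mul_div_assoc', div_le_iff₀ (by positivity)] at hc2
        calc _ ≤ _ := hc2
          _ = _ := by rw [← mul_pow, ← mul_pow]; congr 1; ring
      have m3 : ρ ^ t = ρ ^ d * δ ^ (-(a * p * d)) * δ ^ (θ * (t - s)) := by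
        rw [hρ, ← Real.rpow_natCast, ← Real.rpow_mul hδ.le, ← Real.rpow_mul hδ.le,
          ← Real.rpow_add hδ, ← Real.rpow_add hδ, ← hs']
        congr 1; ring
      have m4 : (δ ^ (a * p)) ^ d * δ ^ (-(a * p * d)) = 1 := by
        rw [← Real.rpow_natCast, ← Real.rpow_mul hδ.le, ← Real.rpow_add hδ]; simp
      calc (F2.card : ℝ) * ρ ^ t ≤ P2.card * ρ ^ t := by gcongr
        _ = (P2.card * ρ ^ d) * (δ ^ (-(a * p * d)) * δ ^ (θ * (t - s))) := by rw [m3]; ring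
        _ ≤ (8 ^ d * (δ ^ (a * p)) ^ d) * (δ ^ (-(a * p * d)) * δ ^ (θ * (t - s))) := by gcongr
        _ = 8 ^ d * ((δ ^ (a * p)) ^ d * δ ^ (-(a * p * d))) * δ ^ (θ * (t - s)) := by ring
        _ = _ := by rw [m4]; ring

lemma sInf_eq_of_Ioi {S : Set ℝ} {s : ℝ} (h1 : ∀ t, s < t → t ∈ S) (h2 : ∀ t ∈ S, s ≤ t) :
    sInf S = s := by
  refine le_antisymm ?_ (le_csInf ⟨s + 1, h1 _ (by linarith)⟩ h2)
  refine le_of_forall_gt_imp_ge_of_dense fun t ht => ?_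
  exact csInf_le ⟨s, h2⟩ (h1 t ht)

theorem stmt0 (d : ℕ) (hd : 2 ≤ d) (p θ : ℝ) (hp : 0 < p) (hp' : p < 1 / ((d : ℝ) - 1))
    (hθ : 0 < θ) (hθ' : θ ≤ 1) :
    lodim θ (concentric d p) =
        ((d : ℝ) * p * ((d : ℝ) - 1) + (d : ℝ) * θ * (1 - p * ((d : ℝ) - 1))) /
          ((d : ℝ) * p + θ * (1 - p * ((d : ℝ) - 1))) ∧
      updim θ (concentric d p) =
        ((d : ℝ) * p * ((d : ℝ) - 1) + (d : ℝ) * θ * (1 - p * ((d : ℝ) - 1))) /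
          ((d : ℝ) * p + θ * (1 - p * ((d : ℝ) - 1))) := by
  have hd2 : (0 : ℝ) < (d : ℝ) - 1 := by
    have : (2 : ℝ) ≤ d := by exact_mod_cast hd
    linarith
  have hd0 : (0 : ℝ) < d := by linarith
  obtain ⟨Q, hQ⟩ : ∃ Q : ℝ, Q = 1 - p * ((d : ℝ) - 1) := ⟨_, rfl⟩
  have hQ0 : 0 < Q := by
    rw [lt_div_iff₀ hd2] at hp'
    linarith
  have hp1 : p ≤ 1 := by
    refine hp'.le.trans ?_
    rw [div_le_one hd2]
    have : (2 : ℝ) ≤ d := by exact_mod_cast hd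
    linarith
  rw [← hQ]
  have hD0 : 0 < (d : ℝ) * p + θ * Q := by positivity
  obtain ⟨a, hadef⟩ : ∃ a : ℝ, a = θ / ((d : ℝ) * p + θ * Q) := ⟨_, rfl⟩
  have ha : 0 < a := by rw [hadef]; positivity
  have hap : a * p ≤ θ := by
    rw [hadef, div_mul_eq_mul_div, div_le_iff₀ hD0]
    have : 0 ≤ θ * Q := by positivity
    have : 0 ≤ p * ((d : ℝ) - 1) := by positivity
    exact mul_le_mul_of_nonneg_left (by linarith) hθ.le
  obtain ⟨s, hsdef⟩ : ∃ s : ℝ, s = ((d : ℝ) * p * ((d : ℝ) - 1) + (d : ℝ) * θ * Q) /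
      ((d : ℝ) * p + θ * Q) := ⟨_, rfl⟩
  rw [← hsdef]
  have hs : s = (d : ℝ) - 1 + a * Q := by
    rw [hsdef, hadef]; field_simp; ring
  have hs' : θ * (d - s) = a * p * d := by
    rw [hsdef, hadef]; field_simp; ring
  have hs0 : 0 ≤ s := by rw [hs]; positivity
  obtain ⟨c, hc, hlow⟩ := lower_bound d hd p θ Q a s hp hθ hQ hQ0 ha hs hs'
  obtain ⟨C, hC, hup⟩ := upper_bound d hd p θ Q a s hp hp1 hθ hθ' hQ hQ0 ha hap hs hs'
  have hU : ∀ t, s < t → ∀ ε : ℝ, 0 < ε → ∃ δ₀ : ℝ, 0 < δ₀ ∧ ∀ δ : ℝ, 0 < δ → δ < δ₀ →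
      ∃ 𝒰 : Set (Set (EuclideanSpace ℝ (Fin d))), 𝒰.Countable ∧ concentric d p ⊆ ⋃₀ 𝒰 ∧
      (∀ U ∈ 𝒰, δ ≤ diam U ∧ diam U ≤ δ ^ θ) ∧
      ∑' U : 𝒰, ENNReal.ofReal (diam (U : Set (EuclideanSpace ℝ (Fin d))) ^ t) ≤
        ENNReal.ofReal ε := by
    intro t ht ε hε
    have hk : 0 < θ * (t - s) := mul_pos hθ (by linarith)
    refine ⟨min 1 ((ε / C) ^ (1 / (θ * (t - s)))), by positivity, fun δ hδ hlt => ?_⟩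
    obtain ⟨h1, h2⟩ := lt_min_iff.1 hlt
    obtain ⟨𝒰, g1, g2, g3, g4⟩ := hup δ hδ h1 t ht.le
    refine ⟨𝒰, g1, g2, g3, g4.trans (ENNReal.ofReal_le_ofReal ?_)⟩
    have h3 := Real.rpow_le_rpow hδ.le h2.le hk.le
    rw [← Real.rpow_mul (by positivity), one_div_mul_cancel hk.ne', Real.rpow_one,
      le_div_iff₀ hC] at h3
    linarith
  have hL : ∀ t : ℝ, (∀ ε : ℝ, 0 < ε → ∀ δ₀ : ℝ, 0 < δ₀ → ∃ δ : ℝ, 0 < δ ∧ δ < δ₀ ∧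
      ∃ 𝒰 : Set (Set (EuclideanSpace ℝ (Fin d))), 𝒰.Countable ∧ concentric d p ⊆ ⋃₀ 𝒰 ∧
      (∀ U ∈ 𝒰, δ ≤ diam U ∧ diam U ≤ δ ^ θ) ∧
      ∑' U : 𝒰, ENNReal.ofReal (diam (U : Set (EuclideanSpace ℝ (Fin d))) ^ t) ≤
        ENNReal.ofReal ε) → s ≤ t := by
    intro t h
    by_contra hts
    push Not at hts
    obtain ⟨δ, hδ, hδ1, 𝒰, g1, g2, g3, g4⟩ := h (c / 2) (by positivity) 1 one_pos
    have h1 := hlow δ hδ hδ1 𝒰 g1 g2 g3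
    have h2 : ∑' U : 𝒰, ENNReal.ofReal (diam (U : Set (EuclideanSpace ℝ (Fin d))) ^ s) ≤
        ∑' U : 𝒰, ENNReal.ofReal (diam (U : Set (EuclideanSpace ℝ (Fin d))) ^ t) := by
      refine ENNReal.tsum_le_tsum fun U => ENNReal.ofReal_le_ofReal ?_
      obtain ⟨k1, k2⟩ := g3 U U.2
      exact Real.rpow_le_rpow_of_exponent_ge (hδ.trans_le k1)
        (k2.trans (Real.rpow_le_one hδ.le hδ1.le hθ.le)) hts.le
    have h3 := h1.trans (h2.trans g4)
    rw [ENNReal.ofReal_le_ofReal_iff (by positivity)] at h3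
    linarith
  have hUL : ∀ t : ℝ, (∀ ε : ℝ, 0 < ε → ∃ δ₀ : ℝ, 0 < δ₀ ∧ ∀ δ : ℝ, 0 < δ → δ < δ₀ →
      ∃ 𝒰 : Set (Set (EuclideanSpace ℝ (Fin d))), 𝒰.Countable ∧ concentric d p ⊆ ⋃₀ 𝒰 ∧
      (∀ U ∈ 𝒰, δ ≤ diam U ∧ diam U ≤ δ ^ θ) ∧
      ∑' U : 𝒰, ENNReal.ofReal (diam (U : Set (EuclideanSpace ℝ (Fin d))) ^ t) ≤
        ENNReal.ofReal ε) → (∀ ε : ℝ, 0 < ε → ∀ δ₀ : ℝ, 0 < δ₀ → ∃ δ : ℝ, 0 < δ ∧ δ < δ₀ ∧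
      ∃ 𝒰 : Set (Set (EuclideanSpace ℝ (Fin d))), 𝒰.Countable ∧ concentric d p ⊆ ⋃₀ 𝒰 ∧
      (∀ U ∈ 𝒰, δ ≤ diam U ∧ diam U ≤ δ ^ θ) ∧
      ∑' U : 𝒰, ENNReal.ofReal (diam (U : Set (EuclideanSpace ℝ (Fin d))) ^ t) ≤
        ENNReal.ofReal ε) := by
    intro t h ε hε δ₀ hδ₀
    obtain ⟨δ₁, hδ₁, h'⟩ := h ε hε
    have hm : 0 < min δ₀ δ₁ := lt_min hδ₀ hδ₁
    have e1 := min_le_left δ₀ δ₁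
    have e2 := min_le_right δ₀ δ₁
    exact ⟨min δ₀ δ₁ / 2, by positivity, by linarith, h' _ (by positivity) (by linarith)⟩
  constructor
  · exact sInf_eq_of_Ioi (fun t ht => ⟨hs0.trans ht.le, hUL t (hU t ht)⟩)
      (fun t ht => hL t ht.2)
  · exact sInf_eq_of_Ioi (fun t ht => ⟨hs0.trans ht.le, hU t ht⟩)
      (fun t ht => hL t (hUL t ht.2))
end

section
/- Let d ≥ 2 be an integer, let p ≥ 1/(d-1), and let θ ∈ (0,1]. Then the lower and upper θ-intermediate dimensions of the set C_p^d of concentric spheres both equal d - 1, i.e. lodim_θ(C_p^d) = updim_θ(C_p^d) = d - 1. -/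
open Set Metric Filter

open MeasureTheory in
lemma lower_aux (m : ℕ) (p : ℝ) (𝒰 : Set (Set (EuclideanSpace ℝ (Fin (m+1)))))
    (hc : 𝒰.Countable) (hcov : concentric (m+1) p ⊆ ⋃₀ 𝒰) (hb : ∀ U ∈ 𝒰, 0 < diam U) :
    volume (closedBall (0 : Fin m → ℝ) (1 / (m + 1))) ≤
      ∑' U : 𝒰, ENNReal.ofReal (diam (U : Set (EuclideanSpace ℝ (Fin (m+1)))) ^ m) := by
  let π : EuclideanSpace ℝ (Fin (m+1)) → (Fin m → ℝ) := fun x i => x i.succ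
  have hπ : LipschitzWith 1 π := by
    refine LipschitzWith.of_dist_le_mul fun x y => ?_
    simp only [NNReal.coe_one, one_mul]
    refine (dist_pi_le_iff dist_nonneg).2 fun i => ?_
    have := PiLp.norm_apply_le (x - y) i.succ
    simpa [dist_eq_norm, π] using this
  have hcov2 : closedBall (0 : Fin m → ℝ) (1 / (m + 1)) ⊆ ⋃ U : 𝒰, π '' U := by
    intro y hy
    have hy' : ∀ i, |y i| ≤ 1 / (m + 1) := by
      rw [mem_closedBall, dist_zero_right] at hy
      exact fun i => (norm_le_pi_norm y i).trans hy
    have hs : ∑ i, (y i)^2 ≤ 1 := by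
      calc ∑ i, (y i)^2 ≤ ∑ i : Fin m, (1 / ((m:ℝ) + 1)) := by
            refine Finset.sum_le_sum fun i _ => ?_
            have h1 : (1 / ((m:ℝ) + 1)) ≤ 1 := by
              rw [div_le_one (by positivity)]; linarith [Nat.cast_nonneg (α := ℝ) m]
            have h2 := hy' i
            rw [← sq_abs]
            nlinarith [abs_nonneg (y i)]
        _ ≤ 1 := by
            simp only [Finset.sum_const, Finset.card_univ, Fintype.card_fin, nsmul_eq_mul]
            rw [mul_one_div, div_le_one (by positivity)]; linarith
    let x : EuclideanSpace ℝ (Fin (m+1)) :=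
      WithLp.toLp 2 (Fin.cons (√(1 - ∑ i, (y i)^2)) y : Fin (m+1) → ℝ)
    have hx : ‖x‖ = 1 := by
      rw [EuclideanSpace.norm_eq, Real.sqrt_eq_one, Fin.sum_univ_succ]
      simp only [x, Fin.cons_zero, Fin.cons_succ, Real.norm_eq_abs, sq_abs]
      rw [Real.sq_sqrt (by linarith)]; ring
    obtain ⟨U, hU, hxU⟩ := hcov (show x ∈ concentric (m+1) p from ⟨1, le_rfl, by simp [hx]⟩)
    refine mem_iUnion.2 ⟨⟨U, hU⟩, x, hxU, ?_⟩
    ext i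
    simp [π, x]
  have := hc.to_subtype
  calc _ ≤ volume (⋃ U : 𝒰, π '' U) := measure_mono hcov2
    _ ≤ ∑' U : 𝒰, volume (π '' U) := measure_iUnion_le _
    _ ≤ _ := by
      refine ENNReal.tsum_le_tsum fun U => ?_
      have hbd : ediam (U : Set (EuclideanSpace ℝ (Fin (m+1)))) ≠ ⊤ := by
        intro h
        have := hb U U.2
        rw [diam, h] at this
        simp at this
      have h1 := Real.volume_pi_le_diam_pow (π '' (U : Set (EuclideanSpace ℝ (Fin (m+1)))))
      have h2 := hπ.ediam_image_le (U : Set (EuclideanSpace ℝ (Fin (m+1))))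
      rw [ENNReal.ofReal_pow diam_nonneg, diam, ENNReal.ofReal_toReal hbd]
      simp only [Fintype.card_fin] at h1
      refine h1.trans ?_
      gcongr
      simpa using h2

/-- maximal separated sets -/
lemma exists_sep {X : Type*} [PseudoMetricSpace X] (E : Set X) (r : ℝ) :
    ∃ S ⊆ E, S.Pairwise (fun x y => r ≤ dist x y) ∧ ∀ x ∈ E, ∃ y ∈ S, dist x y ≤ max r 0 := by
  obtain ⟨S, hS⟩ := zorn_subset {S : Set X | S ⊆ E ∧ S.Pairwise (fun x y => r ≤ dist x y)} (by
    intro c hc hch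
    refine ⟨⋃₀ c, ⟨sUnion_subset fun s hs => (hc hs).1, ?_⟩, fun s hs => subset_sUnion_of_mem hs⟩
    rw [Set.pairwise_sUnion hch.directedOn]
    exact fun s hs => (hc hs).2)
  refine ⟨S, hS.prop.1, hS.prop.2, fun x hx => ?_⟩
  by_contra! hcon
  have hins : insert x S ∈ {S : Set X | S ⊆ E ∧ S.Pairwise (fun x y => r ≤ dist x y)} := by
    refine ⟨insert_subset hx hS.prop.1, ?_⟩
    refine hS.prop.2.insert fun y hy _ => ?_
    have := hcon y hy
    have h2 := le_max_left r 0
    exact ⟨by linarith, by rw [dist_comm]; linarith⟩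
  have hxS : x ∈ S := hS.le_of_ge hins (subset_insert _ _) (mem_insert _ _)
  have := hcon x hxS
  simp at this

open MeasureTheory in
lemma annulus_vol (m : ℕ) (r δ : ℝ) (hr : 0 ≤ r) (hδ : 0 < δ) :
    volume ({y : EuclideanSpace ℝ (Fin (m+1)) | |‖y‖ - r| < δ}) ≤
      ENNReal.ofReal (2 * (m + 1) * δ * (r + δ) ^ m) *
        volume (ball (0 : EuclideanSpace ℝ (Fin (m+1))) 1) := by
  set B := volume (ball (0 : EuclideanSpace ℝ (Fin (m+1))) 1) with hB
  set b := max (r - δ) 0 with hb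
  have hb0 : 0 ≤ b := le_max_right _ _
  have hbr : b ≤ r + δ := max_le (by linarith) (by linarith)
  have hb2 : r - δ ≤ b := le_max_left _ _
  have hsub : {y : EuclideanSpace ℝ (Fin (m+1)) | |‖y‖ - r| < δ} ⊆
      ball 0 (r + δ) \ ball 0 b := by
    intro y hy
    rw [mem_ofPred_eq, abs_lt] at hy
    simp only [Set.mem_sdiff, mem_ball, dist_zero_right, not_lt]
    exact ⟨by linarith, max_le (by linarith) (norm_nonneg _)⟩
  refine (measure_mono hsub).trans ?_
  rw [measure_sdiff (ball_subset_ball hbr) measurableSet_ball.nullMeasurableSet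
    measure_ball_lt_top.ne, Measure.addHaar_ball _ _ (by positivity : (0:ℝ) ≤ r + δ),
    Measure.addHaar_ball _ _ hb0, ← ENNReal.sub_mul (fun _ _ => measure_ball_lt_top.ne),
    ← ENNReal.ofReal_sub _ (by positivity)]
  refine mul_le_mul_left (ENNReal.ofReal_le_ofReal ?_) _
  rw [finrank_euclideanSpace, Fintype.card_fin]
  have h1 : (r+δ)^(m+1) - b^(m+1) =
      (∑ i ∈ Finset.range (m+1), (r+δ)^i * b^(m+1-1-i)) * (r + δ - b) :=
    (Commute.all _ _).geom_sum₂_mul (m+1) |>.symm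
  have h2 : (∑ i ∈ Finset.range (m+1), (r+δ)^i * b^(m+1-1-i)) ≤ (m+1) * (r+δ)^m := by
    calc _ ≤ ∑ i ∈ Finset.range (m+1), (r+δ)^m := by
          refine Finset.sum_le_sum fun i hi => ?_
          have hi' : i ≤ m := by simpa [Nat.lt_succ_iff] using hi
          calc (r+δ)^i * b^(m+1-1-i) ≤ (r+δ)^i * (r+δ)^(m+1-1-i) := by gcongr
            _ = (r+δ)^m := by rw [← pow_add]; congr 1; omega
      _ = _ := by simp
  rw [h1]
  calc _ ≤ ((m+1) * (r+δ)^m) * (2 * δ) := by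
        refine mul_le_mul h2 (by linarith) (by linarith) (by positivity)
    _ = _ := by ring

open MeasureTheory in
lemma nbhd_vol (m : ℕ) (hm : 1 ≤ m) (p : ℝ) (hp : 1 ≤ p * m) (δ : ℝ) (hδ : 0 < δ) (hδ1 : δ < 1) :
    volume (⋃ x ∈ concentric (m+1) p, ball x δ) ≤
      ENNReal.ofReal (δ * (2^(m+2) + 2 * (m+1) * 2^m * (3 + Real.log 2 - Real.log δ))) *
        volume (ball (0 : EuclideanSpace ℝ (Fin (m+1))) 1) := by
  set B := volume (ball (0 : EuclideanSpace ℝ (Fin (m+1))) 1) with hB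
  have hm' : (1:ℝ) ≤ m := by exact_mod_cast hm
  have hp0 : 0 < p := by
    by_contra h
    push Not at h
    nlinarith
  set N := ⌈1/δ⌉₊ with hN
  have hN1 : 1/δ ≤ N := Nat.le_ceil _
  have hδ' : 1 < 1/δ := by rw [lt_div_iff₀ hδ]; linarith
  have hN2 : (N:ℝ) ≤ 2 / δ := by
    have := (Nat.ceil_lt_add_one (by positivity : 0 ≤ 1/δ)).le
    rw [← hN] at this
    have h2 : 2/δ = 1/δ + 1/δ := by ring
    linarith
  have hN0 : (1:ℝ) < N := by linarith
  have hpow : ∀ n : ℕ, 1 ≤ n → ((n:ℝ)^(-p))^m ≤ (n:ℝ)⁻¹ := by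
    intro n hn
    have hn' : (1:ℝ) ≤ n := by exact_mod_cast hn
    rw [← Real.rpow_natCast, ← Real.rpow_mul (by positivity), ← Real.rpow_neg_one]
    exact Real.rpow_le_rpow_of_exponent_le hn' (by linarith)
  have hsub : (⋃ x ∈ concentric (m+1) p, ball x δ) ⊆
      ball 0 ((N:ℝ)^(-p) + δ) ∪ ⋃ n ∈ Finset.Icc 1 N,
        {y : EuclideanSpace ℝ (Fin (m+1)) | |‖y‖ - (n:ℝ)^(-p)| < δ} := by
    intro y hy
    simp only [mem_iUnion] at hy
    obtain ⟨x, ⟨n, hn, hx⟩, hy⟩ := hy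
    rw [mem_ball, dist_eq_norm] at hy
    have h1 : |‖y‖ - (n:ℝ)^(-p)| < δ := by
      rw [← hx]; exact (abs_norm_sub_norm_le y x).trans_lt hy
    by_cases hnN : n ≤ N
    · right
      simp only [mem_iUnion]
      exact ⟨n, Finset.mem_Icc.2 ⟨hn, hnN⟩, h1⟩
    · left
      rw [mem_ball, dist_zero_right]
      have h2 : (n:ℝ)^(-p) ≤ (N:ℝ)^(-p) :=
        Real.rpow_le_rpow_of_nonpos (by linarith) (by exact_mod_cast (by omega : N ≤ n))
          (by linarith)
      rw [abs_lt] at h1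
      linarith
  have hfirst : volume (ball (0:EuclideanSpace ℝ (Fin (m+1))) ((N:ℝ)^(-p) + δ)) ≤
      ENNReal.ofReal (2^(m+2) * δ) * B := by
    rw [Measure.addHaar_ball _ _ (by positivity : 0 ≤ (N:ℝ)^(-p) + δ),
      finrank_euclideanSpace, Fintype.card_fin]
    refine mul_le_mul_left (ENNReal.ofReal_le_ofReal ?_) _
    have h1 : (N:ℝ)^(-p) ≤ 1 := Real.rpow_le_one_of_one_le_of_nonpos hN0.le (by linarith)
    have h2 := hpow N (by exact_mod_cast hN0.le)
    have h3 : (N:ℝ)⁻¹ ≤ δ := by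
      rw [inv_le_comm₀ (by linarith) hδ]; simpa using hN1
    have h0 : 0 ≤ (N:ℝ)^(-p) := by positivity
    have h4 : ((N:ℝ)^(-p))^(m+1) ≤ δ := by
      rw [pow_succ]
      calc _ ≤ ((N:ℝ)^(-p))^m * 1 := by gcongr
        _ ≤ δ := by linarith
    have h5 : δ^(m+1) ≤ δ := by
      simpa using pow_le_pow_of_le_one hδ.le hδ1.le (by omega : 1 ≤ m + 1)
    calc _ ≤ 2^(m+1-1) * (((N:ℝ)^(-p))^(m+1) + δ^(m+1)) := add_pow_le h0 hδ.le _
      _ ≤ 2^m * (δ + δ) := by simp only [Nat.add_sub_cancel]; gcongr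
      _ ≤ 2^(m+2) * δ := by
        have : (0:ℝ) < 2^m * δ := by positivity
        rw [pow_add]; linarith
  have hsecond : volume (⋃ n ∈ Finset.Icc 1 N,
        {y : EuclideanSpace ℝ (Fin (m+1)) | |‖y‖ - (n:ℝ)^(-p)| < δ}) ≤
      ENNReal.ofReal (2 * (m+1) * 2^m * (3 + Real.log 2 - Real.log δ) * δ) * B := by
    refine (measure_biUnion_finset_le _ _).trans ?_
    refine (Finset.sum_le_sum fun (n : ℕ) _ => annulus_vol m ((n:ℝ)^(-p)) δ
      (Real.rpow_nonneg (Nat.cast_nonneg n) _) hδ).trans ?_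
    rw [← Finset.sum_mul, ← ENNReal.ofReal_sum_of_nonneg (fun n _ => by
      have : 0 ≤ (n:ℝ)^(-p) := by positivity
      positivity)]
    refine mul_le_mul_left (ENNReal.ofReal_le_ofReal ?_) _
    have hH : ∑ n ∈ Finset.Icc 1 N, ((n:ℝ))⁻¹ ≤ 1 + Real.log N := by
      have := harmonic_le_one_add_log N
      rw [harmonic_eq_sum_Icc] at this
      push_cast at this
      exact this
    have hlog : Real.log N ≤ Real.log 2 - Real.log δ := by
      rw [← Real.log_div (by norm_num) hδ.ne']
      exact Real.log_le_log (by linarith) hN2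
    have hNd : (N:ℝ) * δ^m ≤ 2 := by
      calc (N:ℝ) * δ^m ≤ (2/δ) * δ^1 := by
            gcongr ?_ * ?_
            exact pow_le_pow_of_le_one hδ.le hδ1.le hm
        _ = 2 := by field_simp
    calc ∑ n ∈ Finset.Icc 1 N, 2 * ((m:ℝ)+1) * δ * ((n:ℝ)^(-p) + δ)^m
        ≤ ∑ n ∈ Finset.Icc 1 N, 2 * ((m:ℝ)+1) * δ * (2^m * ((n:ℝ)⁻¹ + δ^m)) := by
          refine Finset.sum_le_sum fun n hn => ?_
          have hn1 := (Finset.mem_Icc.1 hn).1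
          gcongr
          calc _ ≤ 2^(m-1) * (((n:ℝ)^(-p))^m + δ^m) := add_pow_le (by positivity) hδ.le _
            _ ≤ _ := by
              gcongr
              · norm_num
              · omega
              · exact hpow n hn1
      _ = 2 * ((m:ℝ)+1) * 2^m * δ * (∑ n ∈ Finset.Icc 1 N, ((n:ℝ))⁻¹ + N * δ^m) := by
          rw [← Finset.mul_sum, ← Finset.mul_sum, Finset.sum_add_distrib]
          simp only [Finset.sum_const, Nat.card_Icc, Nat.add_sub_cancel, nsmul_eq_mul]
          ring
      _ ≤ 2 * ((m:ℝ)+1) * 2^m * δ * (3 + Real.log 2 - Real.log δ) := by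
          gcongr; linarith
      _ = _ := by ring
  refine (measure_mono hsub).trans ((measure_union_le _ _).trans
    ((add_le_add hfirst hsecond).trans_eq ?_))
  have hl2 : 0 < Real.log 2 := Real.log_pos (by norm_num)
  have hld : Real.log δ < 0 := Real.log_neg hδ hδ1
  have hnn : 0 ≤ 3 + Real.log 2 - Real.log δ := by linarith
  rw [← add_mul, ← ENNReal.ofReal_add (by positivity) (by positivity)]
  congr 2
  ring

open MeasureTheory in
lemma cover_aux (m : ℕ) (hm : 1 ≤ m) (p : ℝ) (hp : 1 ≤ p * m) (s δ : ℝ) (hδ : 0 < δ)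
    (hδ1 : δ < 1) :
    ∃ 𝒰 : Set (Set (EuclideanSpace ℝ (Fin (m+1)))), 𝒰.Countable ∧ concentric (m+1) p ⊆ ⋃₀ 𝒰 ∧
      (∀ U ∈ 𝒰, diam U = δ) ∧
      ∑' U : 𝒰, ENNReal.ofReal (diam (U : Set (EuclideanSpace ℝ (Fin (m+1)))) ^ s) ≤
        ENNReal.ofReal (4^(m+1) * (δ^(s-m) *
          (2^(m+2) + 2 * (m+1) * 2^m * (3 + Real.log 2 - Real.log δ)))) := by
  set B := volume (ball (0 : EuclideanSpace ℝ (Fin (m+1))) 1) with hB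
  have hB0 : B ≠ 0 := (measure_ball_pos _ _ one_pos).ne'
  have hBt : B ≠ ⊤ := measure_ball_lt_top.ne
  obtain ⟨S, hSE, hSsep, hScov⟩ := exists_sep (concentric (m+1) p) (δ/2)
  rw [max_eq_left (by positivity)] at hScov
  have hdisj : S.PairwiseDisjoint (fun x => ball x (δ/4)) := by
    intro x hx y hy hxy
    exact ball_disjoint_ball (by have := hSsep hx hy hxy; linarith)
  have hcount : S.Countable := hdisj.countable_of_isOpen (fun _ _ => isOpen_ball)
    (fun x _ => ⟨x, mem_ball_self (by positivity)⟩)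
  have hdiam : ∀ x : EuclideanSpace ℝ (Fin (m+1)), diam (closedBall x (δ/2)) = δ := by
    intro x
    rw [Metric.diam_closedBall_eq x (by positivity)]; ring
  refine ⟨(fun x => closedBall x (δ/2)) '' S, hcount.image _, ?_, ?_, ?_⟩
  · intro x hx
    obtain ⟨y, hy, hxy⟩ := hScov x hx
    exact ⟨_, ⟨y, hy, rfl⟩, hxy⟩
  · rintro _ ⟨x, _, rfl⟩
    exact hdiam x
  · set C := (2^(m+2) + 2 * ((m:ℝ)+1) * 2^m * (3 + Real.log 2 - Real.log δ)) with hC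
    have h1 : ∑' x : S, volume (ball (x : EuclideanSpace ℝ (Fin (m+1))) (δ/4)) ≤
        ENNReal.ofReal (δ * C) * B := by
      refine (tsum_meas_le_meas_iUnion_of_disjoint volume
        (As := fun x : S => ball (x : EuclideanSpace ℝ (Fin (m+1))) (δ/4))
        (fun _ => measurableSet_ball) (fun x y hxy => hdisj x.2 y.2 (fun h => hxy (Subtype.ext h)))).trans ?_
      refine le_trans (measure_mono ?_) (nbhd_vol m hm p hp δ hδ hδ1)
      refine iUnion_subset fun x => ?_
      exact (ball_subset_ball (by linarith)).trans
        (subset_biUnion_of_mem (u := fun x => ball x δ) (hSE x.2))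
    have h2 : ∑' x : S, ENNReal.ofReal ((δ/4)^(m+1)) ≤ ENNReal.ofReal (δ * C) := by
      have h3 : ∀ x : S, volume (ball (x : EuclideanSpace ℝ (Fin (m+1))) (δ/4)) =
          ENNReal.ofReal ((δ/4)^(m+1)) * B := by
        intro x
        rw [Measure.addHaar_ball _ _ (by positivity), finrank_euclideanSpace, Fintype.card_fin]
      simp_rw [h3] at h1
      rw [ENNReal.tsum_mul_right] at h1
      exact (ENNReal.mul_le_mul_iff_left hB0 hBt).1 h1
    calc _ ≤ ∑' x : S, ENNReal.ofReal (δ^s) := by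
          refine (ENNReal.tsum_le_tsum_comp_of_surjective
            (f := fun x : S => (⟨closedBall x (δ/2), x, x.2, rfl⟩ :
              ((fun x => closedBall x (δ/2)) '' S))) ?_ _).trans ?_
          · rintro ⟨_, x, hx, rfl⟩
            exact ⟨⟨x, hx⟩, rfl⟩
          · simp only [hdiam]; exact le_rfl
      _ = ENNReal.ofReal (δ^s / (δ/4)^(m+1)) * ∑' x : S, ENNReal.ofReal ((δ/4)^(m+1)) := by
          rw [← ENNReal.tsum_mul_left]
          congr 1; ext x
          rw [← ENNReal.ofReal_mul (by positivity), div_mul_cancel₀ _ (by positivity)]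
      _ ≤ ENNReal.ofReal (δ^s / (δ/4)^(m+1)) * ENNReal.ofReal (δ * C) := by gcongr
      _ = _ := by
          rw [← ENNReal.ofReal_mul (by positivity)]
          congr 1
          rw [Real.rpow_sub hδ, Real.rpow_natCast, div_pow]
          field_simp
          try ring

lemma upper_mem (m : ℕ) (hm : 1 ≤ m) (p : ℝ) (hp : 1 ≤ p * m) (s : ℝ) (hs : (m:ℝ) < s)
    (ε : ℝ) (hε : 0 < ε) :
    ∃ δ₀ : ℝ, 0 < δ₀ ∧ δ₀ ≤ 1 ∧ ∀ δ : ℝ, 0 < δ → δ < δ₀ →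
    ∃ 𝒰 : Set (Set (EuclideanSpace ℝ (Fin (m+1)))), 𝒰.Countable ∧ concentric (m+1) p ⊆ ⋃₀ 𝒰 ∧
      (∀ U ∈ 𝒰, diam U = δ) ∧
      ∑' U : 𝒰, ENNReal.ofReal (diam (U : Set (EuclideanSpace ℝ (Fin (m+1)))) ^ s) ≤
        ENNReal.ofReal ε := by
  have ht : Tendsto (fun δ : ℝ => 4^(m+1) * (δ^(s-m) *
          (2^(m+2) + 2 * ((m:ℝ)+1) * 2^m * (3 + Real.log 2 - Real.log δ))))
          (nhdsWithin 0 (Ioi 0)) (nhds 0) := by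
    have h1 := tendsto_log_mul_rpow_nhdsGT_zero (sub_pos.2 hs)
    have h2 : Tendsto (fun δ : ℝ => δ^(s-m)) (nhdsWithin 0 (Ioi 0)) (nhds 0) := by
      have := (Real.continuousAt_rpow_const 0 (s-m) (Or.inr (sub_pos.2 hs).le)).tendsto
      rw [Real.zero_rpow (sub_pos.2 hs).ne'] at this
      exact this.mono_left nhdsWithin_le_nhds
    have h3 := ((h2.mul_const (2^(m+2) + 2 * ((m:ℝ)+1) * 2^m * (3 + Real.log 2))).sub
      (h1.const_mul (2 * ((m:ℝ)+1) * 2^m))).const_mul (4^(m+1) : ℝ)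
    simp only [zero_mul, mul_zero, sub_zero] at h3
    refine h3.congr fun δ => ?_
    ring
  have hev := ht.eventually (gt_mem_nhds hε)
  rw [eventually_nhdsWithin_iff, Metric.eventually_nhds_iff] at hev
  obtain ⟨η, hη, hev⟩ := hev
  refine ⟨min η 1, lt_min hη one_pos, min_le_right _ _, fun δ hδ hδ0 => ?_⟩
  obtain ⟨𝒰, h1, h2, h3, h4⟩ := cover_aux m hm p hp s δ hδ (hδ0.trans_le (min_le_right _ _))
  refine ⟨𝒰, h1, h2, h3, h4.trans (ENNReal.ofReal_le_ofReal (hev ?_ hδ).le)⟩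
  rw [Real.dist_eq, sub_zero, abs_of_pos hδ]
  exact hδ0.trans_le (min_le_left _ _)

lemma sInf_aux (A : Set ℝ) (a : ℝ) (h1 : ∀ s ∈ A, a ≤ s) (h2 : ∀ s, a < s → s ∈ A) :
    sInf A = a := by
  refine csInf_eq_of_forall_ge_of_forall_gt_exists_lt ⟨a + 1, h2 _ (by linarith)⟩ h1 ?_
  intro w hw
  exact ⟨(a + w) / 2, h2 _ (by linarith), by linarith⟩

theorem stmt1 (d : ℕ) (hd : 2 ≤ d) (p θ : ℝ) (hp : 1 / ((d : ℝ) - 1) ≤ p)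
    (hθ : 0 < θ) (hθ' : θ ≤ 1) :
    lodim θ (concentric d p) = (d : ℝ) - 1 ∧ updim θ (concentric d p) = (d : ℝ) - 1 := by
  obtain ⟨m, rfl⟩ : ∃ m, d = m + 1 := ⟨d - 1, by omega⟩
  have hm : 1 ≤ m := by omega
  have hm' : (1:ℝ) ≤ m := by exact_mod_cast hm
  have hdm : ((m + 1 : ℕ) : ℝ) - 1 = m := by push_cast; ring
  rw [hdm] at hp ⊢
  have hp' : 1 ≤ p * m := by rwa [div_le_iff₀ (by linarith)] at hp
  have hlow : ∀ s : ℝ, (∀ ε : ℝ, 0 < ε → ∀ δ₀ : ℝ, 0 < δ₀ → ∃ δ : ℝ, 0 < δ ∧ δ < δ₀ ∧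
    ∃ 𝒰 : Set (Set (EuclideanSpace ℝ (Fin (m+1)))), 𝒰.Countable ∧ concentric (m+1) p ⊆ ⋃₀ 𝒰 ∧
      (∀ U ∈ 𝒰, δ ≤ diam U ∧ diam U ≤ δ ^ θ) ∧
      ∑' U : 𝒰, ENNReal.ofReal (diam (U : Set (EuclideanSpace ℝ (Fin (m+1)))) ^ s) ≤
        ENNReal.ofReal ε) → (m:ℝ) ≤ s := by
    intro s hs
    by_contra! hsm
    set V := MeasureTheory.volume (closedBall (0 : Fin m → ℝ) (1 / (m + 1))) with hV
    have hV0 : V ≠ 0 := (measure_closedBall_pos _ _ (by positivity)).ne'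
    have hVt : V ≠ ⊤ := MeasureTheory.measure_closedBall_lt_top.ne
    have hVr : 0 < V.toReal := ENNReal.toReal_pos hV0 hVt
    obtain ⟨δ, hδ, hδ1, 𝒰, h1, h2, h3, h4⟩ := hs (V.toReal / 2) (by positivity) 1 one_pos
    have h5 := lower_aux m p 𝒰 h1 h2 (fun U hU => hδ.trans_le (h3 U hU).1)
    have h6 : V ≤ ENNReal.ofReal (V.toReal / 2) := by
      refine h5.trans (le_trans (ENNReal.tsum_le_tsum fun U => ENNReal.ofReal_le_ofReal ?_) h4)
      have h7 := h3 U U.2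
      rw [← Real.rpow_natCast]
      exact Real.rpow_le_rpow_of_exponent_ge (hδ.trans_le h7.1)
        (h7.2.trans (Real.rpow_le_one hδ.le hδ1.le hθ.le)) hsm.le
    rw [← ENNReal.ofReal_toReal hVt, ENNReal.toReal_ofReal hVr.le,
      ENNReal.ofReal_le_ofReal_iff (by positivity)] at h6
    linarith
  have hδθ : ∀ δ : ℝ, 0 < δ → δ < 1 → δ ≤ δ ^ θ := by
    intro δ h0 h1
    simpa using Real.rpow_le_rpow_of_exponent_ge h0 h1.le hθ'
  constructor
  · refine sInf_aux _ _ (fun s hs => hlow s hs.2) fun s hs => ⟨by linarith, fun ε hε δ₁ hδ₁ => ?_⟩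
    obtain ⟨δ₀, h0, h01, h⟩ := upper_mem m hm p hp' s hs ε hε
    have hmin : 0 < min δ₀ δ₁ := lt_min h0 hδ₁
    have ha := min_le_left δ₀ δ₁
    have hb := min_le_right δ₀ δ₁
    obtain ⟨𝒰, h1, h2, h3, h4⟩ := h (min δ₀ δ₁ / 2) (by linarith) (by linarith)
    refine ⟨min δ₀ δ₁ / 2, by linarith, by linarith, 𝒰, h1, h2, fun U hU => ?_, h4⟩
    rw [h3 U hU]
    exact ⟨le_rfl, hδθ _ (by linarith) (by linarith)⟩
  · refine sInf_aux _ _ (fun s hs => hlow s fun ε hε δ₁ hδ₁ => ?_) fun s hs =>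
      ⟨by linarith, fun ε hε => ?_⟩
    · obtain ⟨δ₀, h0, h⟩ := hs.2 ε hε
      have hmin : 0 < min δ₀ δ₁ := lt_min h0 hδ₁
      have ha := min_le_left δ₀ δ₁
      have hb := min_le_right δ₀ δ₁
      exact ⟨min δ₀ δ₁ / 2, by linarith, by linarith, h _ (by linarith) (by linarith)⟩
    · obtain ⟨δ₀, h0, h01, h⟩ := upper_mem m hm p hp' s hs ε hε
      refine ⟨δ₀, h0, fun δ hδ hδ0 => ?_⟩
      obtain ⟨𝒰, h1, h2, h3, h4⟩ := h δ hδ hδ0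
      refine ⟨𝒰, h1, h2, fun U hU => ?_, h4⟩
      rw [h3 U hU]
      exact ⟨le_rfl, hδθ _ hδ (by linarith)⟩
end

section
/- Let p ≥ 1 and θ ∈ (0,1]. Then the lower and upper θ-intermediate dimensions of the polynomial spiral S_p both equal 1, i.e. lodim_θ(S_p) = updim_θ(S_p) = 1. -/
open Set Metric Filter

/-- The polynomial spiral `S_p = {(t^{-p} sin(πt), t^{-p} cos(πt)) : t ≥ 1} ⊆ ℝ²`. -/
noncomputable def polySpiral (p : ℝ) : Set (EuclideanSpace ℝ (Fin 2)) :=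
  {x | ∃ t : ℝ, 1 ≤ t ∧ x 0 = t ^ (-p) * Real.sin (Real.pi * t) ∧
    x 1 = t ^ (-p) * Real.cos (Real.pi * t)}

lemma spiral_lower (p θ s : ℝ) (hs : s ≤ 1) (hθ : 0 < θ)
    (h : ∀ ε : ℝ, 0 < ε → ∀ δ₀ : ℝ, 0 < δ₀ → ∃ δ : ℝ, 0 < δ ∧ δ < δ₀ ∧
    ∃ 𝒰 : Set (Set (EuclideanSpace ℝ (Fin 2))), 𝒰.Countable ∧ polySpiral p ⊆ ⋃₀ 𝒰 ∧
      (∀ U ∈ 𝒰, δ ≤ diam U ∧ diam U ≤ δ ^ θ) ∧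
      ∑' U : 𝒰, ENNReal.ofReal (diam (U : Set (EuclideanSpace ℝ (Fin 2))) ^ s)
        ≤ ENNReal.ofReal ε) : False := by
  obtain ⟨δ, hδ, hδ1, 𝒰, hc, hcov, hU, hsum⟩ := h (1/2) (by norm_num) 1 one_pos
  have hproj : Icc (-1 : ℝ) 0 ⊆ ⋃ U ∈ 𝒰, (fun x : EuclideanSpace ℝ (Fin 2) => x 1) '' U := by
    intro y hy
    have hcont : ContinuousOn (fun t : ℝ => t ^ (-p) * Real.cos (Real.pi * t)) (Icc 1 2) := by
      apply ContinuousOn.mul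
      · intro t ht
        exact (Real.continuousAt_rpow_const t (-p)
          (Or.inl (by have := ht.1; linarith))).continuousWithinAt
      · fun_prop
    have hivt := intermediate_value_Icc (by norm_num : (1:ℝ) ≤ 2) hcont
    have hy' : y ∈ Icc ((fun t : ℝ => t ^ (-p) * Real.cos (Real.pi * t)) 1)
        ((fun t : ℝ => t ^ (-p) * Real.cos (Real.pi * t)) 2) := by
      have h2 : (0:ℝ) ≤ 2 ^ (-p) := by positivity
      have h3 : Real.cos (Real.pi * 2) = 1 := by rw [mul_comm, Real.cos_two_pi]
      simp only [h3, Real.one_rpow, mul_one, Real.cos_pi]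
      exact ⟨by linarith [hy.1], by linarith [hy.2]⟩
    obtain ⟨t, ht, hty⟩ := hivt hy'
    have hmem : (!₂[t ^ (-p) * Real.sin (Real.pi * t), t ^ (-p) * Real.cos (Real.pi * t)] :
        EuclideanSpace ℝ (Fin 2)) ∈ polySpiral p := ⟨t, ht.1, by simp, by simp⟩
    obtain ⟨U, hU1, hU2⟩ := hcov hmem
    simp only [mem_iUnion]
    exact ⟨U, hU1, _, hU2, by simpa using hty⟩
  have h1 : (1 : ENNReal) ≤ ENNReal.ofReal (1/2) := by
    calc (1 : ENNReal) = MeasureTheory.volume (Icc (-1 : ℝ) 0) := by simp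
      _ ≤ MeasureTheory.volume (⋃ U ∈ 𝒰, (fun x : EuclideanSpace ℝ (Fin 2) => x 1) '' U) :=
        MeasureTheory.measure_mono hproj
      _ ≤ ∑' U : 𝒰, MeasureTheory.volume ((fun x : EuclideanSpace ℝ (Fin 2) => x 1) '' U) :=
        MeasureTheory.measure_biUnion_le _ hc _
      _ ≤ ∑' U : 𝒰, ENNReal.ofReal (diam (U : Set (EuclideanSpace ℝ (Fin 2))) ^ s) := by
        apply ENNReal.tsum_le_tsum
        rintro ⟨U, hUm⟩
        have hd := hU U hUm
        have hpos : 0 < diam U := hδ.trans_le hd.1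
        have hle1 : diam U ≤ 1 := hd.2.trans (Real.rpow_le_one hδ.le hδ1.le hθ.le)
        have hne : ediam U ≠ ⊤ := by
          intro htop
          simp [diam, htop] at hpos
        calc MeasureTheory.volume ((fun x : EuclideanSpace ℝ (Fin 2) => x 1) '' U)
            ≤ ediam ((fun x : EuclideanSpace ℝ (Fin 2) => x 1) '' U) := Real.volume_le_diam _
          _ ≤ ediam U := by
            rw [ediam_image_le_iff]
            intro x hx y hy
            refine le_trans ?_ (edist_le_ediam_of_mem hx hy)
            rw [edist_dist, edist_dist]
            apply ENNReal.ofReal_le_ofReal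
            simpa [dist_eq_norm] using PiLp.norm_apply_le (x - y) 1
          _ = ENNReal.ofReal (diam U) := (ENNReal.ofReal_toReal hne).symm
          _ ≤ ENNReal.ofReal (diam U ^ s) := by
            apply ENNReal.ofReal_le_ofReal
            simpa using Real.rpow_le_rpow_of_exponent_ge hpos hle1 hs
      _ ≤ _ := hsum
  rw [ENNReal.one_le_ofReal] at h1
  norm_num at h1

lemma spiral_lip (p : ℝ) (hp : 1 ≤ p) (f g : ℝ → ℝ) (hf : ∀ x, HasDerivAt f (g x) x)
    (hf1 : ∀ x, |f x| ≤ 1) (hg1 : ∀ x, |g x| ≤ 1) (u v : ℝ) (hu : 0 ≤ u) (hv : 0 ≤ v) :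
    |Real.exp (u * -p) * f (Real.pi * Real.exp u) -
      Real.exp (v * -p) * f (Real.pi * Real.exp v)| ≤ (p + Real.pi) * |u - v| := by
  have hd : ∀ w ∈ Ici (0:ℝ), HasDerivWithinAt
      (fun w => Real.exp (w * -p) * f (Real.pi * Real.exp w))
      (Real.exp (w * -p) * (1 * -p) * f (Real.pi * Real.exp w) +
        Real.exp (w * -p) * (g (Real.pi * Real.exp w) * (Real.pi * Real.exp w))) (Ici 0) w := by
    intro w _
    exact ((((hasDerivAt_id w).mul_const (-p)).exp).mul
      ((hf _).comp w ((Real.hasDerivAt_exp w).const_mul Real.pi))).hasDerivWithinAt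
  have := Convex.norm_image_sub_le_of_norm_hasDerivWithin_le (C := p + Real.pi) hd (by
    intro w hw
    have hw : 0 ≤ w := hw
    have e1 : Real.exp (w * -p) ≤ 1 := Real.exp_le_one_iff.2 (by nlinarith)
    have e2 : Real.exp (w * -p) * Real.exp w ≤ 1 := by
      rw [← Real.exp_add]; exact Real.exp_le_one_iff.2 (by nlinarith)
    have e0 := Real.exp_pos (w * -p)
    have e3 := Real.exp_pos w
    refine (norm_add_le _ _).trans (add_le_add ?_ ?_)
    · rw [Real.norm_eq_abs, abs_mul, abs_mul, one_mul, abs_neg, abs_of_pos e0,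
        abs_of_pos (by linarith : 0 < p)]
      calc _ ≤ 1 * p * 1 := by gcongr; exact hf1 _
        _ = p := by ring
    · rw [Real.norm_eq_abs, abs_mul, abs_mul, abs_of_pos e0,
        abs_of_pos (mul_pos Real.pi_pos e3)]
      calc _ = |g (Real.pi * Real.exp w)| * Real.pi * (Real.exp (w * -p) * Real.exp w) := by ring
        _ ≤ 1 * Real.pi * 1 := by
          have := Real.pi_pos
          gcongr; exact hg1 _
        _ = Real.pi := by ring) (convex_Ici 0) (x := v) (y := u) hv hu
  simpa [Real.norm_eq_abs] using this

lemma dist_le_coord (x y : EuclideanSpace ℝ (Fin 2)) :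
    dist x y ≤ |x 0 - y 0| + |x 1 - y 1| := by
  rw [EuclideanSpace.dist_eq, Fin.sum_univ_two, Real.dist_eq, Real.dist_eq]
  apply Real.sqrt_le_iff.2
  constructor
  · positivity
  · nlinarith [abs_nonneg (x 0 - y 0), abs_nonneg (x 1 - y 1)]

lemma spiral_cover (p δ : ℝ) (hp : 1 ≤ p) (hδ : 0 < δ) (hδ1 : δ < 1) :
    ∃ 𝒰 : Finset (Set (EuclideanSpace ℝ (Fin 2))), polySpiral p ⊆ ⋃₀ (𝒰 : Set (Set _)) ∧
      (∀ U ∈ 𝒰, diam U = δ) ∧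
      (𝒰.card : ℝ) ≤ Real.log (4 / δ) * (4 * (p + Real.pi)) / δ + 2 := by
  classical
  have hpi := Real.pi_pos
  set C := p + Real.pi with hC
  have hCpos : 0 < C := by linarith
  set h := δ / (4 * C) with hh
  have hhpos : 0 < h := by positivity
  set L := Real.log (4 / δ) with hL
  have hL0 : 0 ≤ L := Real.log_nonneg (by rw [le_div_iff₀ hδ]; linarith)
  set c : ℕ → EuclideanSpace ℝ (Fin 2) := fun k =>
    !₂[Real.exp (k * h * -p) * Real.sin (Real.pi * Real.exp (k * h)),
      Real.exp (k * h * -p) * Real.cos (Real.pi * Real.exp (k * h))] with hc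
  refine ⟨insert (closedBall 0 (δ/2))
    ((Finset.range (⌊L / h⌋₊ + 1)).image fun k => closedBall (c k) (δ/2)), ?_, ?_, ?_⟩
  · rintro x ⟨t, ht, hx0, hx1⟩
    have htp : 0 < t := by linarith
    rw [Real.rpow_def_of_pos htp] at hx0 hx1
    set u := Real.log t with hu
    have hu0 : 0 ≤ u := Real.log_nonneg ht
    have htu : t = Real.exp u := (Real.exp_log htp).symm
    rw [htu] at hx0 hx1
    by_cases huL : u ≤ L
    · refine ⟨closedBall (c ⌊u / h⌋₊) (δ/2), ?_, ?_⟩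
      · simp only [Finset.coe_insert, Finset.coe_image]
        right
        refine ⟨⌊u/h⌋₊, ?_, rfl⟩
        simp only [Finset.coe_range, mem_Iio]
        exact Nat.lt_succ_of_le (Nat.floor_le_floor (by gcongr))
      · rw [mem_closedBall]
        have hk1 : (⌊u/h⌋₊ : ℝ) * h ≤ u := by
          have := Nat.floor_le (div_nonneg hu0 hhpos.le)
          rwa [le_div_iff₀ hhpos] at this
        have hk2 : u ≤ (⌊u/h⌋₊ : ℝ) * h + h := by
          have := (Nat.lt_floor_add_one (u/h)).le
          rw [div_le_iff₀ hhpos] at this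
          linarith
        have hk0 : 0 ≤ (⌊u/h⌋₊ : ℝ) * h := by positivity
        have habs : |u - (⌊u/h⌋₊ : ℝ) * h| ≤ h := by
          rw [abs_le]; constructor <;> linarith
        have a0 := spiral_lip p hp Real.sin Real.cos Real.hasDerivAt_sin
          Real.abs_sin_le_one Real.abs_cos_le_one u _ hu0 hk0
        have a1 := spiral_lip p hp Real.cos (fun x => - Real.sin x) Real.hasDerivAt_cos
          Real.abs_cos_le_one (fun x => by rw [abs_neg]; exact Real.abs_sin_le_one x) u _ hu0 hk0
        refine (dist_le_coord _ _).trans ?_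
        have hfin : C * |u - (⌊u/h⌋₊ : ℝ) * h| ≤ δ / 4 := by
          calc _ ≤ C * h := by gcongr
            _ = δ / 4 := by rw [hh]; field_simp
        have b0 : c ⌊u/h⌋₊ 0 = Real.exp (⌊u/h⌋₊ * h * -p) *
          Real.sin (Real.pi * Real.exp (⌊u/h⌋₊ * h)) := by simp [hc]
        have b1 : c ⌊u/h⌋₊ 1 = Real.exp (⌊u/h⌋₊ * h * -p) *
          Real.cos (Real.pi * Real.exp (⌊u/h⌋₊ * h)) := by simp [hc]
        rw [hx0, hx1, b0, b1]
        linarith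
    · refine ⟨closedBall 0 (δ/2), by simp, ?_⟩
      rw [mem_closedBall]
      refine (dist_le_coord _ _).trans ?_
      push Not at huL
      have e : Real.exp (u * -p) ≤ δ / 4 := by
        calc Real.exp (u * -p) ≤ Real.exp (-L) := Real.exp_le_exp.2 (by nlinarith)
          _ = δ / 4 := by rw [Real.exp_neg, hL, Real.exp_log (by positivity), inv_div]
      have e0 := Real.exp_pos (u * -p)
      rw [hx0, hx1]
      simp only [PiLp.zero_apply, sub_zero, abs_mul, abs_of_pos e0]
      have := Real.abs_sin_le_one (Real.pi * Real.exp u)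
      have := Real.abs_cos_le_one (Real.pi * Real.exp u)
      nlinarith
  · intro U hU
    rw [Finset.mem_insert, Finset.mem_image] at hU
    rcases hU with rfl | ⟨k, _, rfl⟩
    · rw [diam_closedBall_eq _ (by positivity)]; ring
    · rw [diam_closedBall_eq _ (by positivity)]; ring
  · have h1 := (Finset.card_insert_le (closedBall (0 : EuclideanSpace ℝ (Fin 2)) (δ/2))
      ((Finset.range (⌊L / h⌋₊ + 1)).image fun k => closedBall (c k) (δ/2))).trans
      (Nat.add_le_add_right Finset.card_image_le 1)
    rw [Finset.card_range] at h1
    have h2 : (⌊L/h⌋₊ : ℝ) ≤ L / h := Nat.floor_le (by positivity)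
    have h3 : L / h = L * (4 * C) / δ := by rw [hh]; field_simp
    rw [← h3]
    calc _ ≤ ((⌊L / h⌋₊ + 1 + 1 : ℕ) : ℝ) := by exact_mod_cast h1
      _ ≤ _ := by push_cast; linarith

lemma spiral_upper (p θ s : ℝ) (hp : 1 ≤ p) (hθ' : θ ≤ 1) (hs : 1 < s) :
    ∀ ε : ℝ, 0 < ε → ∃ δ₀ : ℝ, 0 < δ₀ ∧ ∀ δ : ℝ, 0 < δ → δ < δ₀ →
    ∃ 𝒰 : Set (Set (EuclideanSpace ℝ (Fin 2))), 𝒰.Countable ∧ polySpiral p ⊆ ⋃₀ 𝒰 ∧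
      (∀ U ∈ 𝒰, δ ≤ diam U ∧ diam U ≤ δ ^ θ) ∧
      ∑' U : 𝒰, ENNReal.ofReal (diam (U : Set (EuclideanSpace ℝ (Fin 2))) ^ s)
        ≤ ENNReal.ofReal ε := by
  intro ε hε
  have hs1 : 0 < s - 1 := by linarith
  have l1 := tendsto_log_mul_rpow_nhdsGT_zero hs1
  have l2 : ∀ r : ℝ, 0 < r → Tendsto (fun x : ℝ => x ^ r) (nhdsWithin 0 (Ioi 0)) (nhds 0) := by
    intro r hr
    have := (Real.continuousAt_rpow_const 0 r (Or.inr hr.le)).tendsto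
    rw [Real.zero_rpow hr.ne'] at this
    exact this.mono_left nhdsWithin_le_nhds
  have l3 := ((((l2 _ hs1).const_mul (Real.log 4)).sub l1).mul_const (4 * (p + Real.pi))).add
    ((l2 s (by linarith)).const_mul 2)
  simp only [mul_zero, sub_zero, zero_mul, add_zero] at l3
  have ev := l3.eventually_lt_const hε
  rw [eventually_nhdsWithin_iff, Metric.eventually_nhds_iff] at ev
  obtain ⟨r, hr, hev⟩ := ev
  refine ⟨min r 1, by positivity, fun δ hδ hδr => ?_⟩
  have hδ1 : δ < 1 := hδr.trans_le (min_le_right _ _)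
  have hb := hev (y := δ) (by rw [Real.dist_eq, sub_zero, abs_of_pos hδ]
                              exact hδr.trans_le (min_le_left _ _)) hδ
  obtain ⟨𝒰, hcov, hd, hcard⟩ := spiral_cover p δ hp hδ hδ1
  refine ⟨𝒰, 𝒰.countable_toSet, hcov, ?_, ?_⟩
  · intro U hU
    rw [hd U hU]
    refine ⟨le_rfl, ?_⟩
    simpa using Real.rpow_le_rpow_of_exponent_ge hδ hδ1.le hθ'
  · have : ∑' U : (𝒰 : Set (Set (EuclideanSpace ℝ (Fin 2)))),
        ENNReal.ofReal (diam (U : Set (EuclideanSpace ℝ (Fin 2))) ^ s)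
        = ∑ U ∈ 𝒰, ENNReal.ofReal (diam U ^ s) :=
      Finset.tsum_subtype 𝒰 (fun U => ENNReal.ofReal (diam U ^ s))
    rw [this, Finset.sum_congr rfl (fun U hU => by rw [hd U hU]), Finset.sum_const,
      nsmul_eq_mul, ← ENNReal.ofReal_natCast, ← ENNReal.ofReal_mul (by positivity)]
    apply ENNReal.ofReal_le_ofReal
    refine le_trans ?_ hb.le
    have hsp : 0 < δ ^ s := Real.rpow_pos_of_pos hδ s
    have hsm : δ ^ (s - 1) = δ ^ s / δ := Real.rpow_sub_one hδ.ne' s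
    calc _ ≤ (Real.log (4 / δ) * (4 * (p + Real.pi)) / δ + 2) * δ ^ s := by gcongr
      _ = _ := by
        rw [Real.log_div (by norm_num) hδ.ne', hsm]; ring

theorem stmt4 (p θ : ℝ) (hp : 1 ≤ p) (hθ : 0 < θ) (hθ' : θ ≤ 1) :
    lodim θ (polySpiral p) = 1 ∧ updim θ (polySpiral p) = 1 := by
  have key : ∀ S : Set ℝ, (∀ s ∈ S, 1 < s) → (∀ s, 1 < s → s ∈ S) → sInf S = 1 := by
    intro S h1 h2
    have : S = Ioi 1 := Set.ext fun s => ⟨h1 s, h2 s⟩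
    rw [this, csInf_Ioi]
  constructor
  · apply key
    · rintro s ⟨_, h⟩
      by_contra hs
      exact spiral_lower p θ s (not_lt.1 hs) hθ h
    · intro s hs
      refine ⟨by linarith, fun ε hε δ₁ hδ₁ => ?_⟩
      obtain ⟨δ₀, hδ₀, h⟩ := spiral_upper p θ s hp hθ' hs ε hε
      have hm : 0 < min δ₀ δ₁ := lt_min hδ₀ hδ₁
      exact ⟨min δ₀ δ₁ / 2, by positivity, by linarith [min_le_right δ₀ δ₁],
        h _ (by positivity) (by linarith [min_le_left δ₀ δ₁])⟩
  · apply key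
    · rintro s ⟨_, h⟩
      by_contra hs
      refine spiral_lower p θ s (not_lt.1 hs) hθ fun ε hε δ₁ hδ₁ => ?_
      obtain ⟨δ₀, hδ₀, h⟩ := h ε hε
      have hm : 0 < min δ₀ δ₁ := lt_min hδ₀ hδ₁
      exact ⟨min δ₀ δ₁ / 2, by positivity, by linarith [min_le_right δ₀ δ₁],
        h _ (by positivity) (by linarith [min_le_left δ₀ δ₁])⟩
    · intro s hs
      exact ⟨by linarith, spiral_upper p θ s hp hθ' hs⟩
end

section
/- Let d ≥ 2 be an integer, p > 0, and let (a_n)_{n∈ℕ} be a strictly decreasing sequence of positive reals converging to 0 with limsup_{n→∞} a_n·n^p < 1. Then for every θ ∈ (0,1], updim_θ(C^d({a_n})) ≤ updim_θ(C_p^d). -/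
open Set Metric Filter

/-- `C^d({a_n})`: the union over `n` of the spheres in `ℝ^d` of radius `a n` centred at
the origin. -/
noncomputable def concentricSeq (d : ℕ) (a : ℕ → ℝ) : Set (EuclideanSpace ℝ (Fin d)) :=
  {x | ∃ n : ℕ, ‖x‖ = a n}


namespace ConcAux

open MeasureTheory

abbrev X (m : ℕ) := EuclideanSpace ℝ (Fin (m + 1))

/-- Covering by balls from a volume bound. -/
lemma cover_of_vol (m : ℕ) (E A : Set (X m)) (h V : ℝ) (hh : 0 < h) (hV : 0 ≤ V)
    (hA : ∀ x ∈ E, closedBall x h ⊆ A)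
    (hvol : volume A ≤ ENNReal.ofReal (V * h ^ (m + 1)) * volume (ball (0 : X m) 1)) :
    ∃ F : Finset (X m), (F.card : ℝ) ≤ V ∧ ∀ x ∈ E, ∃ c ∈ F, x ∈ closedBall c (2 * h) := by
  classical
  have key : ∀ F : Finset (X m), (∀ x ∈ F, x ∈ E) →
      (∀ x ∈ F, ∀ y ∈ F, x ≠ y → 2 * h < dist x y) → (F.card : ℝ) ≤ V := by
    intro F hF hs
    have hb0 : volume (ball (0 : X m) 1) ≠ 0 := (measure_ball_pos _ _ one_pos).ne'
    have hbt : volume (ball (0 : X m) 1) ≠ ⊤ := measure_ball_lt_top.ne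
    have h1 : volume (⋃ x ∈ F, closedBall x h) = ∑ x ∈ F, volume (closedBall x h) := by
      apply measure_biUnion_finset
      · intro x hx y hy hxy
        apply closedBall_disjoint_closedBall
        have := hs x hx y hy hxy
        linarith
      · intro x hx
        exact measurableSet_closedBall
    have h2 : volume (⋃ x ∈ F, closedBall x h) ≤ volume A :=
      measure_mono (iUnion₂_subset fun x hx => hA x (hF x hx))
    have h3 : ∀ x : X m, volume (closedBall x h) =
        ENNReal.ofReal (h ^ (m + 1)) * volume (ball (0 : X m) 1) := by
      intro x
      rw [Measure.addHaar_closedBall _ x hh.le]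
      simp
    rw [h1, Finset.sum_congr rfl fun x _ => h3 x, Finset.sum_const, nsmul_eq_mul, ← mul_assoc] at h2
    have h4 := h2.trans hvol
    rw [ENNReal.mul_le_mul_iff_left hb0 hbt] at h4
    rw [← ENNReal.ofReal_natCast, ← ENNReal.ofReal_mul (by positivity),
      ENNReal.ofReal_le_ofReal_iff (by positivity)] at h4
    exact le_of_mul_le_mul_right h4 (by positivity)
  let P : ℕ → Prop := fun k => ∃ F : Finset (X m), F.card = k ∧ (∀ x ∈ F, x ∈ E) ∧
      (∀ x ∈ F, ∀ y ∈ F, x ≠ y → 2 * h < dist x y)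
  have hP0 : P 0 := ⟨∅, by simp, by simp, by simp⟩
  have hb : ∀ k, P k → k ≤ ⌊V⌋₊ := by
    rintro k ⟨F, rfl, h1, h2⟩
    exact Nat.le_floor (key F h1 h2)
  have hspec := Nat.findGreatest_spec (P := P) (Nat.zero_le ⌊V⌋₊) hP0
  obtain ⟨F, hc, hF, hs⟩ := hspec
  refine ⟨F, key F hF hs, ?_⟩
  intro x hx
  by_contra hcon
  push Not at hcon
  have hcon' : ∀ c ∈ F, 2 * h < dist x c := by
    intro c hcF
    have := hcon c hcF
    rw [mem_closedBall] at this
    linarith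
  have hxF : x ∉ F := by
    intro hxF
    have := hcon' x hxF
    simp at this
    linarith
  have hP : P (F.card + 1) := by
    refine ⟨insert x F, Finset.card_insert_of_notMem hxF, ?_, ?_⟩
    · intro y hy
      rcases Finset.mem_insert.1 hy with rfl | hy
      · exact hx
      · exact hF y hy
    · intro y hy z hz hyz
      rcases Finset.mem_insert.1 hy with hy1 | hy1 <;> rcases Finset.mem_insert.1 hz with hz1 | hz1
      · exact absurd (hy1.trans hz1.symm) hyz
      · rw [hy1]; exact hcon' z hz1
      · rw [hz1, dist_comm]; exact hcon' y hy1
      · exact hs y hy1 z hz1 hyz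
  have := Nat.le_findGreatest (hb _ hP) hP
  omega

lemma cover_ball (m : ℕ) (R h : ℝ) (hR : 0 ≤ R) (hh : 0 < h) :
    ∃ F : Finset (X m), (F.card : ℝ) ≤ (R / h + 1) ^ (m + 1) ∧
      ∀ x ∈ closedBall (0 : X m) R, ∃ c ∈ F, x ∈ closedBall c (2 * h) := by
  apply cover_of_vol m (closedBall 0 R) (closedBall 0 (R + h)) h _ hh (by positivity)
  · intro x hx
    apply closedBall_subset_closedBall'
    rw [mem_closedBall] at hx
    linarith
  · rw [Measure.addHaar_closedBall _ _ (by positivity : 0 ≤ R + h), ← mul_pow]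
    have : (R / h + 1) * h = R + h := by field_simp
    rw [this]
    simp

lemma cover_sphere (m : ℕ) (R h : ℝ) (hR : 0 ≤ R) (hh : 0 < h) :
    ∃ F : Finset (X m), (F.card : ℝ) ≤ 2 * (m + 1) * (R / h + 1) ^ m ∧
      ∀ x : X m, ‖x‖ = R → ∃ c ∈ F, x ∈ closedBall c (2 * h) := by
  have e : 2 * ((m : ℝ) + 1) * (R / h + 1) ^ m * h ^ (m + 1)
      = 2 * h * (m + 1) * (R + h) ^ m := by
    have : (R / h + 1) * h = R + h := by field_simp
    rw [← this, mul_pow]; ring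
  apply cover_of_vol m {x | ‖x‖ = R} (closedBall 0 (R + h) \ ball 0 (R - h)) h _ hh (by positivity)
  · intro x hx y hy
    simp only [mem_ofPred_eq] at hx
    rw [mem_closedBall, dist_eq_norm] at hy
    have h1 := norm_le_norm_add_norm_sub' y x
    have h2 := norm_le_norm_add_norm_sub' x y
    rw [norm_sub_rev] at h2
    constructor
    · rw [mem_closedBall_zero_iff]; linarith
    · rw [mem_ball_zero_iff]; push Not; linarith
  · rw [e]
    by_cases hRh : R < h
    · refine (measure_mono sdiff_subset).trans ?_
      rw [Measure.addHaar_closedBall _ _ (by positivity : 0 ≤ R + h)]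
      gcongr
      simp only [finrank_euclideanSpace, Fintype.card_fin]
      rw [pow_succ, mul_comm]
      gcongr
      nlinarith [(Nat.cast_nonneg m : (0 : ℝ) ≤ m)]
    · push Not at hRh
      rw [measure_sdiff (ball_subset_closedBall.trans (closedBall_subset_closedBall (by linarith)))
        measurableSet_ball.nullMeasurableSet measure_ball_lt_top.ne,
        Measure.addHaar_closedBall _ _ (by positivity : 0 ≤ R + h),
        Measure.addHaar_ball _ _ (by linarith : 0 ≤ R - h)]
      simp only [finrank_euclideanSpace, Fintype.card_fin]
      rw [← ENNReal.sub_mul (fun _ _ => measure_ball_lt_top.ne), ← ENNReal.ofReal_sub _ (by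
        have : 0 ≤ R - h := by linarith
        positivity)]
      gcongr
      have := abs_pow_sub_pow_le (R + h) (R - h) (m + 1)
      rw [abs_of_nonneg (by linarith : 0 ≤ R + h), abs_of_nonneg (by linarith : 0 ≤ R - h),
        max_eq_left (by linarith), abs_of_nonneg (by linarith : 0 ≤ R + h - (R - h))] at this
      refine (le_abs_self _).trans (this.trans (le_of_eq ?_))
      push_cast
      ring_nf
      try simp

/-- Projection forgetting the first coordinate. -/
def proj (m : ℕ) (x : X m) : Fin m → ℝ := fun i => x i.succ

lemma proj_dist (m : ℕ) (x y : X m) : dist (proj m x) (proj m y) ≤ dist x y := by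
  rw [dist_pi_le_iff dist_nonneg]
  intro i
  have := PiLp.norm_apply_le (x - y) i.succ
  rw [dist_eq_norm, dist_eq_norm]
  simpa [proj] using this

lemma exists_lift (m : ℕ) (ρ : ℝ) (hρ : 0 ≤ ρ) (y : Fin m → ℝ)
    (hy : y ∈ closedBall (0 : Fin m → ℝ) (ρ / (m + 1))) : ∃ x : X m, ‖x‖ = ρ ∧ proj m x = y := by
  have h1 : ∑ i, (y i) ^ 2 ≤ ρ ^ 2 := by
    rw [mem_closedBall_zero_iff] at hy
    have hy2 : ∀ i, (y i) ^ 2 ≤ (ρ / (m + 1)) ^ 2 := by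
      intro i
      have := (norm_le_pi_norm y i).trans hy
      rw [Real.norm_eq_abs] at this
      rw [← sq_abs]
      gcongr
    calc ∑ i, (y i) ^ 2 ≤ ∑ i : Fin m, (ρ / (m + 1)) ^ 2 := Finset.sum_le_sum fun i _ => hy2 i
      _ = m * (ρ / (m + 1)) ^ 2 := by simp
      _ ≤ ρ ^ 2 := by
        have : (m : ℝ) * (ρ / (m + 1)) ^ 2 = ρ ^ 2 * (m / (m + 1) ^ 2) := by
          field_simp
        rw [this]
        have h2 : (m : ℝ) / (m + 1) ^ 2 ≤ 1 := by
          rw [div_le_one (by positivity)]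
          nlinarith [(Nat.cast_nonneg m : (0 : ℝ) ≤ m)]
        exact mul_le_of_le_one_right (sq_nonneg _) h2
  refine ⟨WithLp.toLp 2 (Fin.cons (Real.sqrt (ρ ^ 2 - ∑ i, (y i) ^ 2)) y), ?_, ?_⟩
  · rw [EuclideanSpace.norm_eq, Fin.sum_univ_succ]
    simp only [Fin.cons_zero, Fin.cons_succ, Real.norm_eq_abs, sq_abs]
    rw [Real.sq_sqrt (by linarith), sub_add_cancel, Real.sqrt_sq hρ]
  · ext i
    simp [proj]

open Classical in
/-- Single sphere lower bound. -/
lemma single_sphere (m : ℕ) (ρ : ℝ) (hρ : 0 ≤ ρ) (𝒰 : Set (Set (X m))) (hc : 𝒰.Countable)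
    (hcov : ∀ x : X m, ‖x‖ = ρ → x ∈ ⋃₀ 𝒰) (hd : ∀ U ∈ 𝒰, 0 < diam U) :
    ENNReal.ofReal ((2 * (ρ / (m + 1))) ^ m) ≤
      ∑' U : 𝒰, if ∃ x ∈ (U : Set (X m)), ‖x‖ = ρ then
        ENNReal.ofReal ((2 * diam (U : Set (X m))) ^ m) else 0 := by
  have hv : volume (closedBall (0 : Fin m → ℝ) (ρ / (m + 1)))
      = ENNReal.ofReal ((2 * (ρ / (m + 1))) ^ m) := by
    rw [Real.volume_pi_closedBall _ (by positivity)]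
    simp
  rw [← hv]
  have : Countable 𝒰 := hc.to_subtype
  have hsub : closedBall (0 : Fin m → ℝ) (ρ / (m + 1)) ⊆
      ⋃ U : 𝒰, proj m '' {x | x ∈ (U : Set (X m)) ∧ ‖x‖ = ρ} := by
    intro y hy
    obtain ⟨x, hx, rfl⟩ := exists_lift m ρ hρ y hy
    obtain ⟨U, hU, hxU⟩ := hcov x hx
    exact mem_iUnion.2 ⟨⟨U, hU⟩, x, ⟨hxU, hx⟩, rfl⟩
  refine (measure_mono hsub).trans ((measure_iUnion_le _).trans ?_)
  refine ENNReal.tsum_le_tsum fun U => ?_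
  split_ifs with hex
  · obtain ⟨x, hx, -⟩ := hex
    have hbd : Bornology.IsBounded (U : Set (X m)) := by
      by_contra hnb
      have := hd U U.2
      rw [diam_eq_zero_of_unbounded hnb] at this
      exact lt_irrefl _ this
    calc volume (proj m '' {x | x ∈ (U : Set (X m)) ∧ ‖x‖ = ρ})
        ≤ volume (closedBall (proj m x) (diam (U : Set (X m)))) := by
          apply measure_mono
          rintro _ ⟨z, ⟨hz, -⟩, rfl⟩
          rw [mem_closedBall]
          exact (proj_dist m z x).trans (dist_le_diam_of_mem hbd hz hx)
      _ = _ := by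
          rw [Real.volume_pi_closedBall _ diam_nonneg]
          simp
  · have : {x | x ∈ (U : Set (X m)) ∧ ‖x‖ = ρ} = ∅ := by
      ext x
      simp only [mem_ofPred_eq, mem_empty_iff_false, iff_false]
      exact fun h => hex ⟨x, h⟩
    rw [this]
    simp

lemma gap (p : ℝ) (hp : 0 < p) (n : ℕ) (hn : 1 ≤ n) :
    p * ((n : ℝ) + 1) ^ (-p - 1) ≤ (n : ℝ) ^ (-p) - ((n : ℝ) + 1) ^ (-p) := by
  have hn' : (0 : ℝ) < n := by exact_mod_cast hn
  have h1 : (n : ℝ) ^ (-p) = ((n : ℝ) + 1) ^ (-p) * Real.exp (p * Real.log ((n + 1) / n)) := by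
    rw [Real.rpow_def_of_pos hn', Real.rpow_def_of_pos (by positivity), ← Real.exp_add,
      Real.log_div (by positivity) (by positivity)]
    ring_nf
  have h2 : 1 + p / (n + 1) ≤ Real.exp (p * Real.log ((n + 1) / n)) := by
    have h3 := Real.one_sub_inv_le_log_of_pos (x := ((n : ℝ) + 1) / n) (by positivity)
    have h4 : 1 - (((n : ℝ) + 1) / n)⁻¹ = 1 / (n + 1) := by field_simp; ring
    rw [h4] at h3
    have h5 := Real.add_one_le_exp (p * Real.log (((n : ℝ) + 1) / n))
    have h6 := mul_le_mul_of_nonneg_left h3 hp.le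
    have : p / ((n : ℝ) + 1) = p * (1 / (n + 1)) := by ring
    linarith
  rw [h1, Real.rpow_sub_one (by positivity)]
  have h7 : (0 : ℝ) < ((n : ℝ) + 1) ^ (-p) := by positivity
  have := mul_le_mul_of_nonneg_left h2 h7.le
  have e : ((n : ℝ) + 1) ^ (-p) * (1 + p / (n + 1)) = ((n : ℝ) + 1) ^ (-p) +
    p * (((n : ℝ) + 1) ^ (-p) / (n + 1)) := by ring
  linarith

lemma gap_multi (p : ℝ) (hp : 0 < p) (L n k : ℕ) (hn : 1 ≤ n) (hL : n + k ≤ L) :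
    k * (p * (L : ℝ) ^ (-p - 1)) ≤ (n : ℝ) ^ (-p) - ((n + k : ℕ) : ℝ) ^ (-p) := by
  induction k with
  | zero => simp
  | succ k ih =>
    have h1 := ih (by omega)
    have h2 := gap p hp (n + k) (by omega)
    have h3 : (L : ℝ) ^ (-p - 1) ≤ (((n + k : ℕ) : ℝ) + 1) ^ (-p - 1) := by
      apply Real.rpow_le_rpow_of_nonpos (by positivity) _ (by linarith)
      exact_mod_cast hL
    have h4 := mul_le_mul_of_nonneg_left h3 hp.le
    have e : ((n + (k + 1) : ℕ) : ℝ) = ((n + k : ℕ) : ℝ) + 1 := by push_cast; ring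
    rw [e]
    push_cast at *
    linarith

open Classical in
lemma count_hits (m : ℕ) (p : ℝ) (hp : 0 < p) (M : ℕ) (hM : 1 ≤ M) (U : Set (X m))
    (hd : 0 < diam U) :
    (((Finset.Ioc M (2 * M)).filter fun n : ℕ => ∃ x ∈ U, ‖x‖ = (n : ℝ) ^ (-p)).card : ℝ) ≤
      1 + diam U / (p * ((2 * M : ℕ) : ℝ) ^ (-p - 1)) := by
  set T := (Finset.Ioc M (2 * M)).filter fun n : ℕ => ∃ x ∈ U, ‖x‖ = (n : ℝ) ^ (-p) with hT
  have hg : 0 < p * ((2 * M : ℕ) : ℝ) ^ (-p - 1) := by positivity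
  rcases T.eq_empty_or_nonempty with h0 | hne
  · rw [h0]; simp; positivity
  have hbd : Bornology.IsBounded U := by
    by_contra hnb
    rw [diam_eq_zero_of_unbounded hnb] at hd
    exact lt_irrefl _ hd
  have h1 := T.min'_mem hne
  have h2 := T.max'_mem hne
  set n1 := T.min' hne
  set n2 := T.max' hne
  have h12 : n1 ≤ n2 := T.min'_le _ h2
  have hcard : T.card ≤ n2 - n1 + 1 := by
    have : T ⊆ Finset.Icc n1 n2 := fun n hn => Finset.mem_Icc.2 ⟨T.min'_le _ hn, T.le_max' _ hn⟩
    have := Finset.card_le_card this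
    rw [Nat.card_Icc] at this
    omega
  rw [hT, Finset.mem_filter, Finset.mem_Ioc] at h1 h2
  obtain ⟨h1a, x, hx, hxn⟩ := h1
  obtain ⟨h2a, y, hy, hyn⟩ := h2
  have hdist : (n1 : ℝ) ^ (-p) - (n2 : ℝ) ^ (-p) ≤ diam U := by
    rw [← hxn, ← hyn]
    exact (norm_sub_norm_le _ _).trans (by rw [← dist_eq_norm]; exact dist_le_diam_of_mem hbd hx hy)
  have h3 := gap_multi p hp (2 * M) n1 (n2 - n1) (by omega) (by omega)
  rw [Nat.add_sub_cancel' h12] at h3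
  have h4 : ((n2 - n1 : ℕ) : ℝ) ≤ diam U / (p * ((2 * M : ℕ) : ℝ) ^ (-p - 1)) := by
    rw [le_div_iff₀ hg]
    linarith
  have h5 : (T.card : ℝ) ≤ ((n2 - n1 : ℕ) : ℝ) + 1 := by exact_mod_cast hcard
  linarith

/-- Main lower bound inequality. -/
lemma multi_sphere (m : ℕ) (p : ℝ) (hp : 0 < p) (M : ℕ) (hM : 1 ≤ M) (𝒰 : Set (Set (X m)))
    (hc : 𝒰.Countable) (hcov : concentric (m + 1) p ⊆ ⋃₀ 𝒰) (hd : ∀ U ∈ 𝒰, 0 < diam U) :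
    ENNReal.ofReal (M * (2 * (((2 * M : ℕ) : ℝ) ^ (-p) / (m + 1))) ^ m) ≤
      ∑' U : 𝒰, ENNReal.ofReal ((2 * diam (U : Set (X m))) ^ m *
        (1 + diam (U : Set (X m)) / (p * ((2 * M : ℕ) : ℝ) ^ (-p - 1)))) := by
  classical
  have h1 : ∀ n ∈ Finset.Ioc M (2 * M),
      ENNReal.ofReal ((2 * (((2 * M : ℕ) : ℝ) ^ (-p) / (m + 1))) ^ m) ≤
      ∑' U : 𝒰, if ∃ x ∈ (U : Set (X m)), ‖x‖ = (n : ℝ) ^ (-p) then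
        ENNReal.ofReal ((2 * diam (U : Set (X m))) ^ m) else 0 := by
    intro n hn
    rw [Finset.mem_Ioc] at hn
    refine le_trans ?_ (single_sphere m ((n : ℝ) ^ (-p)) (by positivity) 𝒰 hc
      (fun x hx => hcov ⟨n, by omega, hx⟩) hd)
    gcongr ENNReal.ofReal ((2 * (?_ / _)) ^ m)
    apply Real.rpow_le_rpow_of_nonpos _ _ (by linarith)
    · exact_mod_cast (by omega : 0 < n)
    · exact_mod_cast hn.2
  have h2 := Finset.sum_le_sum h1
  rw [Finset.sum_const, Nat.card_Ioc, nsmul_eq_mul, ← ENNReal.ofReal_natCast,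
    ← ENNReal.ofReal_mul (by positivity), (by omega : 2 * M - M = M)] at h2
  refine h2.trans ?_
  rw [← Summable.tsum_finsetSum (fun _ _ => ENNReal.summable)]
  refine ENNReal.tsum_le_tsum fun U => ?_
  rw [← Finset.sum_filter, Finset.sum_const, nsmul_eq_mul, ← ENNReal.ofReal_natCast,
    ← ENNReal.ofReal_mul (by positivity), mul_comm]
  apply ENNReal.ofReal_le_ofReal
  have := count_hits m p hp M hM U (hd U U.2)
  have h0 : 0 ≤ diam (U : Set (X m)) := diam_nonneg
  gcongr


/-- The set of exponents in the definition of `updim`. -/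
def Adm {Y : Type*} [PseudoMetricSpace Y] (θ : ℝ) (E : Set Y) : Set ℝ :=
  {s : ℝ | 0 ≤ s ∧ ∀ ε : ℝ, 0 < ε → ∃ δ₀ : ℝ, 0 < δ₀ ∧ ∀ δ : ℝ, 0 < δ → δ < δ₀ →
    ∃ 𝒰 : Set (Set Y), 𝒰.Countable ∧ E ⊆ ⋃₀ 𝒰 ∧
      (∀ U ∈ 𝒰, δ ≤ diam U ∧ diam U ≤ δ ^ θ) ∧
      ∑' U : 𝒰, ENNReal.ofReal (diam (U : Set Y) ^ s) ≤ ENNReal.ofReal ε}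

/-- Any admissible exponent exceeds `d - 1`. -/
lemma lower_one (m : ℕ) (p θ s : ℝ) (hθ : 0 < θ) (hs : s ∈ Adm θ (concentric (m + 1) p)) :
    (m : ℝ) < s := by
  by_contra hsm
  push Not at hsm
  obtain ⟨hs0, hs⟩ := hs
  set K : ℝ := (1 / ((m : ℝ) + 1)) ^ m with hK
  have hKpos : 0 < K := by positivity
  obtain ⟨δ₀, hδ₀, H⟩ := hs (K / 2) (by positivity)
  set δ := min (δ₀ / 2) (1 / 2) with hδ
  have hδpos : 0 < δ := by positivity
  have hδ1 : δ ≤ 1 := (min_le_right _ _).trans (by norm_num)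
  obtain ⟨𝒰, hc, hcov, hd, hsum⟩ := H δ hδpos (lt_of_le_of_lt (min_le_left _ _) (by linarith))
  have h1 := single_sphere m 1 zero_le_one 𝒰 hc (fun x hx => hcov ⟨1, le_rfl, by simpa using hx⟩)
    (fun U hU => hδpos.trans_le (hd U hU).1)
  have h2 : ENNReal.ofReal ((2 * (1 / ((m : ℝ) + 1))) ^ m) ≤
      ENNReal.ofReal (2 ^ m) * ∑' U : 𝒰, ENNReal.ofReal (diam (U : Set (X m)) ^ s) := by
    refine h1.trans ?_
    rw [← ENNReal.tsum_mul_left]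
    refine ENNReal.tsum_le_tsum fun U => ?_
    split_ifs
    · rw [← ENNReal.ofReal_mul (by positivity), mul_pow]
      apply ENNReal.ofReal_le_ofReal
      gcongr
      have hpos : 0 < diam (U : Set (X m)) := hδpos.trans_le (hd U U.2).1
      have hle : diam (U : Set (X m)) ≤ 1 := (hd U U.2).2.trans
        (Real.rpow_le_one hδpos.le hδ1 hθ.le)
      rw [← Real.rpow_natCast]
      exact Real.rpow_le_rpow_of_exponent_ge hpos hle hsm
    · exact zero_le
  have h3 := h2.trans (mul_le_mul_right hsum _)
  rw [← ENNReal.ofReal_mul (by positivity), ENNReal.ofReal_le_ofReal_iff (by positivity),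
    mul_pow] at h3
  have := le_of_mul_le_mul_left h3 (by positivity)
  rw [← hK] at this
  linarith

/-- Second constraint on admissible exponents. -/
lemma lower_two (m : ℕ) (p θ s x : ℝ) (hp : 0 < p) (hθ : 0 < θ) 
    (hs : s ∈ Adm θ (concentric (m + 1) p)) (hsd : s < m + 1)
    (hx : x * (1 + p) = (s - m) + θ * (m + 1 - s)) :
    x * (1 - p * m) < s - m := by
  have hms := lower_one m p θ s hθ hs
  have hx0 : 0 < x := by
    have : 0 < x * (1 + p) := by
      rw [hx]
      have := mul_pos hθ (by linarith : 0 < m + 1 - s)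
      linarith
    exact pos_of_mul_pos_left this (by linarith)
  by_contra hcon
  push Not at hcon
  have hq : 0 < 1 - p * m := by
    by_contra h
    push Not at h
    nlinarith
  obtain ⟨hs0, hs⟩ := hs
  -- constants
  set c : ℝ := (2 * ((2 : ℝ) ^ (-p) / (m + 1))) ^ m with hcdef
  have hcpos : 0 < c := by positivity
  set K : ℝ := 2 ^ m * (1 + 2 ^ (p + 1) * 2 ^ (p + 1) / p) with hKdef
  have hKpos : 0 < K := by positivity
  obtain ⟨δ₀, hδ₀, H⟩ := hs (c / (2 * K)) (by positivity)
  set δ := min (δ₀ / 2) (1 / 2) with hδ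
  have hδpos : 0 < δ := by positivity
  have hδ1 : δ ≤ 1 := (min_le_right _ _).trans (by norm_num)
  obtain ⟨𝒰, hc, hcov, hd, hsum⟩ := H δ hδpos (lt_of_le_of_lt (min_le_left _ _) (by linarith))
  set M : ℕ := ⌈δ ^ (-x)⌉₊ with hMdef
  have hδx1 : 1 ≤ δ ^ (-x) := Real.one_le_rpow_of_pos_of_le_one_of_nonpos hδpos hδ1 (by linarith)
  have hM1 : δ ^ (-x) ≤ M := Nat.le_ceil _
  have hM2 : (M : ℝ) ≤ 2 * δ ^ (-x) := by
    have := Nat.ceil_lt_add_one (by positivity : 0 ≤ δ ^ (-x))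
    linarith
  have hMpos : (0 : ℝ) < M := by linarith
  have hMn : 1 ≤ M := by exact_mod_cast hMpos
  have h1 := multi_sphere m p hp M hMn 𝒰 hc hcov (fun U hU => hδpos.trans_le (hd U hU).1)
  set g : ℝ := p * ((2 * M : ℕ) : ℝ) ^ (-p - 1) with hg
  have hgpos : 0 < g := by positivity
  have hginv : 1 / g ≤ 2 ^ (p + 1) * 2 ^ (p + 1) / p * δ ^ (-(s - m) - θ * (m + 1 - s)) := by
    have e1 : 1 / g = (2 ^ (p + 1) * (M : ℝ) ^ (p + 1)) / p := by
      rw [hg, (by ring : -p - 1 = -(p + 1)), Real.rpow_neg (by positivity)]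
      push_cast
      rw [Real.mul_rpow (by positivity) (by positivity)]
      field_simp
    have e2 : (M : ℝ) ^ (p + 1) ≤ 2 ^ (p + 1) * δ ^ (-(s - m) - θ * (m + 1 - s)) := by
      calc (M : ℝ) ^ (p + 1) ≤ (2 * δ ^ (-x)) ^ (p + 1) :=
            Real.rpow_le_rpow hMpos.le hM2 (by linarith)
        _ = _ := by
          rw [Real.mul_rpow (by positivity) (by positivity), ← Real.rpow_mul hδpos.le]
          congr 2
          linarith
    rw [e1]
    calc (2 ^ (p + 1) * (M : ℝ) ^ (p + 1)) / p ≤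
        (2 ^ (p + 1) * (2 ^ (p + 1) * δ ^ (-(s - m) - θ * (m + 1 - s)))) / p := by gcongr
      _ = _ := by ring
  have h2 : ENNReal.ofReal (M * (2 * (((2 * M : ℕ) : ℝ) ^ (-p) / (m + 1))) ^ m) ≤
      ENNReal.ofReal (K * δ ^ (-(s - m))) * ∑' U : 𝒰, ENNReal.ofReal (diam (U : Set (X m)) ^ s) := by
    refine h1.trans ?_
    rw [← ENNReal.tsum_mul_left]
    refine ENNReal.tsum_le_tsum fun U => ?_
    rw [← ENNReal.ofReal_mul (by positivity)]
    apply ENNReal.ofReal_le_ofReal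
    obtain ⟨hr1, hr2⟩ := hd U U.2
    set r := diam (U : Set (X m)) with hr
    have hr0 : 0 < r := hδpos.trans_le hr1
    have a1 : r ^ m ≤ δ ^ (-(s - m)) * r ^ s := by
      have : r ^ m = r ^ (-(s - m)) * r ^ s := by
        rw [← Real.rpow_add hr0, ← Real.rpow_natCast]; congr 1; ring
      rw [this]
      gcongr ?_ * _
      exact Real.rpow_le_rpow_of_nonpos hδpos hr1 (by linarith)
    have a2 : r ^ (m + 1) ≤ δ ^ (θ * (m + 1 - s)) * r ^ s := by
      have : r ^ (m + 1) = r ^ ((m : ℝ) + 1 - s) * r ^ s := by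
        rw [← Real.rpow_add hr0, ← Real.rpow_natCast]; congr 1; push_cast; ring
      rw [this, Real.rpow_mul hδpos.le]
      gcongr ?_ * _
      exact Real.rpow_le_rpow hr0.le hr2 (by linarith)
    have a3 : δ ^ (θ * (m + 1 - s)) * δ ^ (-(s - m) - θ * (m + 1 - s)) = δ ^ (-(s - m)) := by
      rw [← Real.rpow_add hδpos]; congr 1; ring
    calc (2 * r) ^ m * (1 + r / g) = 2 ^ m * (r ^ m + r ^ (m + 1) * (1 / g)) := by
          rw [mul_pow, pow_succ]; ring
      _ ≤ 2 ^ m * (δ ^ (-(s - m)) * r ^ s + (δ ^ (θ * (m + 1 - s)) * r ^ s) *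
          (2 ^ (p + 1) * 2 ^ (p + 1) / p * δ ^ (-(s - m) - θ * (m + 1 - s)))) := by
          gcongr
      _ = 2 ^ m * (δ ^ (-(s - m)) * r ^ s + (δ ^ (θ * (m + 1 - s)) *
          δ ^ (-(s - m) - θ * (m + 1 - s))) * r ^ s *
          (2 ^ (p + 1) * 2 ^ (p + 1) / p)) := by ring
      _ = K * δ ^ (-(s - m)) * r ^ s := by rw [a3, hKdef]; ring
  have h3 := h2.trans (mul_le_mul_right hsum _)
  rw [← ENNReal.ofReal_mul (by positivity), ENNReal.ofReal_le_ofReal_iff (by positivity)] at h3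
  have e3 : M * (2 * (((2 * M : ℕ) : ℝ) ^ (-p) / (m + 1))) ^ m = c * (M : ℝ) ^ (1 - p * m) := by
    have : (M : ℝ) ^ (1 - p * m) = M * ((M : ℝ) ^ (-p)) ^ m := by
      rw [sub_eq_add_neg, Real.rpow_add hMpos, Real.rpow_one, ← Real.rpow_natCast,
        ← Real.rpow_mul hMpos.le]
      congr 2; ring
    rw [this, hcdef]
    push_cast
    rw [Real.mul_rpow (by positivity) (by positivity)]
    have : 2 * ((2 : ℝ) ^ (-p) * (M : ℝ) ^ (-p) / (m + 1)) =
      2 * (2 ^ (-p) / (m + 1)) * (M : ℝ) ^ (-p) := by ring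
    rw [this, mul_pow]
    ring
  have e4 : δ ^ (-(s - m)) ≤ (M : ℝ) ^ (1 - p * m) := by
    calc δ ^ (-(s - m)) ≤ δ ^ (-x * (1 - p * m)) :=
          Real.rpow_le_rpow_of_exponent_ge hδpos hδ1 (by linarith)
      _ = (δ ^ (-x)) ^ (1 - p * m) := Real.rpow_mul hδpos.le _ _
      _ ≤ _ := Real.rpow_le_rpow (by positivity) hM1 hq.le
  rw [e3] at h3
  have e5 : K * δ ^ (-(s - m)) * (c / (2 * K)) = c / 2 * δ ^ (-(s - m)) := by field_simp
  rw [e5] at h3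
  have e6 := mul_le_mul_of_nonneg_left e4 hcpos.le
  have e7 : 0 < δ ^ (-(s - m)) := by positivity
  nlinarith [mul_pos hcpos e7]

lemma sum_bound (q η : ℝ) (hη : 0 < η) (M : ℕ) (hM : 1 ≤ M) :
    ∑ n ∈ Finset.range M, ((n : ℝ) + 1) ^ (-q) ≤ (1 + 1 / η) * (M : ℝ) ^ (max 0 (1 - q) + η) := by
  have hM' : (1 : ℝ) ≤ M := by exact_mod_cast hM
  have hMpos : (0 : ℝ) < M := by linarith
  have h1 : ∀ n ∈ Finset.range M, ((n : ℝ) + 1) ^ (-q) ≤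
      (M : ℝ) ^ (max 0 (1 - q)) * ((n : ℝ) + 1)⁻¹ := by
    intro n hn
    have hn' : (n : ℝ) + 1 ≤ M := by exact_mod_cast Finset.mem_range.1 hn
    have hn0 : (1 : ℝ) ≤ (n : ℝ) + 1 := by linarith [(Nat.cast_nonneg n : (0 : ℝ) ≤ n)]
    have : ((n : ℝ) + 1) ^ (-q) = ((n : ℝ) + 1) ^ (1 - q) * ((n : ℝ) + 1)⁻¹ := by
      rw [← Real.rpow_neg_one ((n : ℝ) + 1), ← Real.rpow_add (by positivity)]
      congr 1; ring
    rw [this]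
    gcongr
    calc ((n : ℝ) + 1) ^ (1 - q) ≤ ((n : ℝ) + 1) ^ (max 0 (1 - q)) :=
          Real.rpow_le_rpow_of_exponent_le hn0 (le_max_right _ _)
      _ ≤ _ := Real.rpow_le_rpow (by positivity) hn' (le_max_left _ _)
  refine (Finset.sum_le_sum h1).trans ?_
  rw [← Finset.mul_sum]
  have h2 : ∑ n ∈ Finset.range M, ((n : ℝ) + 1)⁻¹ ≤ 1 + Real.log M := by
    have := harmonic_le_one_add_log M
    simpa [harmonic] using this
  have h3 := Real.log_le_rpow_div hMpos.le hη
  have h4 : (1 : ℝ) ≤ (M : ℝ) ^ η := Real.one_le_rpow hM' hη.le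
  rw [Real.rpow_add hMpos]
  calc _ ≤ (M : ℝ) ^ (max 0 (1 - q)) * ((M : ℝ) ^ η + (M : ℝ) ^ η / η) := by
        gcongr; linarith
    _ = _ := by ring

lemma upper (m : ℕ) (p θ s x C : ℝ) (hp : 0 < p) (hθ : 0 < θ) (hθ' : θ ≤ 1) (hx : 0 < x)
    (hs : 0 < s) (hC : 0 < C) (a : ℕ → ℝ) (hapos : ∀ n, 0 < a n)
    (haC : ∀ n : ℕ, a n ≤ C * ((n : ℝ) + 1) ^ (-p))
    (h1 : x * max 0 (1 - p * m) < s - m)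
    (h2 : θ * (m + 1 - s) < p * x * (m + 1)) (h3 : p * x ≤ 1) :
    s ∈ Adm θ (concentricSeq (m + 1) a) := by
  classical
  refine ⟨hs.le, fun ε hε => ?_⟩
  obtain ⟨η, hη, hη'⟩ : ∃ η : ℝ, 0 < η ∧ x * (max 0 (1 - p * m) + η) < s - m := by
    refine ⟨(s - m - x * max 0 (1 - p * m)) / (2 * x), div_pos (by linarith) (by positivity), ?_⟩
    rw [mul_add]
    have : x * ((s - m - x * max 0 (1 - p * m)) / (2 * x)) =
      (s - m - x * max 0 (1 - p * m)) / 2 := by field_simp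
    linarith
  set β := max 0 (1 - p * m) + η with hβ
  have hβpos : 0 < β := by positivity
  set e1 := (p * x - θ) * (m + 1) + θ * s with he1
  have he1pos : 0 < e1 := by rw [he1]; nlinarith
  set e2 := s - m - x * β with he2
  have he2pos : 0 < e2 := by linarith
  set K0 : ℝ := 2 ^ (m + 1) * (4 * C) ^ (m + 1) with hK0
  set K1 : ℝ := 2 ^ (m + 1) with hK1
  set K2 : ℝ := 2 * (m + 1) * (4 * C + 2 ^ p) ^ m * ((1 + 1 / η) * 2 ^ β) with hK2
  have hlim : Tendsto (fun δ : ℝ => K0 * δ ^ e1 + K1 * δ ^ (θ * s) + K2 * δ ^ e2)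
      (nhdsWithin 0 (Ioi 0)) (nhds 0) := by
    have hr : ∀ e : ℝ, 0 < e → Tendsto (fun δ : ℝ => δ ^ e) (nhdsWithin 0 (Ioi 0)) (nhds 0) := by
      intro e he
      have := (Real.continuousAt_rpow_const 0 e (Or.inr he.le)).tendsto
      rw [Real.zero_rpow he.ne'] at this
      exact this.mono_left nhdsWithin_le_nhds
    have := (((hr e1 he1pos).const_mul K0).add ((hr (θ * s) (by positivity)).const_mul K1)).add
      ((hr e2 he2pos).const_mul K2)
    simpa using this
  have hev := (hlim.eventually (gt_mem_nhds hε)).and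
    (eventually_nhdsWithin_of_eventually_nhds (gt_mem_nhds (zero_lt_one (α := ℝ))))
  obtain ⟨δ₀, hδ₀, hsub⟩ := mem_nhdsGT_iff_exists_Ioo_subset.1 hev
  refine ⟨δ₀, hδ₀, fun δ hδpos hδlt => ?_⟩
  obtain ⟨hcost, hδ1⟩ := hsub ⟨hδpos, hδlt⟩
  set M : ℕ := ⌈δ ^ (-x)⌉₊ with hMdef
  have hδx1 : 1 ≤ δ ^ (-x) := Real.one_le_rpow_of_pos_of_le_one_of_nonpos hδpos hδ1.le (by linarith)
  have hM1 : δ ^ (-x) ≤ M := Nat.le_ceil _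
  have hM2 : (M : ℝ) ≤ 2 * δ ^ (-x) := by
    have := Nat.ceil_lt_add_one (by positivity : 0 ≤ δ ^ (-x))
    linarith
  have hMpos : (0 : ℝ) < M := by linarith
  have hMn : 1 ≤ M := by exact_mod_cast hMpos
  have hδθ : δ ≤ δ ^ θ := by
    simpa using Real.rpow_le_rpow_of_exponent_ge hδpos hδ1.le hθ'
  have hδθpos : 0 < δ ^ θ := by positivity
  obtain ⟨F0, hF0c, hF0⟩ := cover_ball m (C * (M : ℝ) ^ (-p)) (δ ^ θ / 4) (by positivity)
    (by positivity)
  choose F hFc hF using fun n : ℕ => cover_sphere m (a n) (δ / 4) (hapos n).le (by positivity)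
  let T0 : Finset (Set (X m)) := F0.image fun c => closedBall c (2 * (δ ^ θ / 4))
  let T1 : Finset (Set (X m)) := (Finset.range M).biUnion fun n =>
    (F n).image fun c => closedBall c (2 * (δ / 4))
  have hT0 : ∀ U ∈ T0, diam U = δ ^ θ := by
    intro U hU
    obtain ⟨c, -, rfl⟩ := Finset.mem_image.1 hU
    rw [Metric.diam_closedBall_eq _ (by positivity)]
    ring
  have hT1 : ∀ U ∈ T1, diam U = δ := by
    intro U hU
    obtain ⟨n, -, hU⟩ := Finset.mem_biUnion.1 hU
    obtain ⟨c, -, rfl⟩ := Finset.mem_image.1 hU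
    rw [Metric.diam_closedBall_eq _ (by positivity)]
    ring
  refine ⟨((T0 ∪ T1 : Finset (Set (X m))) : Set (Set (X m))), Finset.countable_toSet _, ?_, ?_, ?_⟩
  · rintro y ⟨n, hn⟩
    by_cases hnM : n < M
    · obtain ⟨c, hc, hyc⟩ := hF n y hn
      refine ⟨closedBall c (2 * (δ / 4)), ?_, hyc⟩
      refine Finset.mem_coe.2 (Finset.mem_union_right _ (Finset.mem_biUnion.2 ⟨n, ?_, ?_⟩))
      · exact Finset.mem_range.2 hnM
      · exact Finset.mem_image.2 ⟨c, hc, rfl⟩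
    · obtain ⟨c, hc, hyc⟩ := hF0 y (by
        rw [mem_closedBall_zero_iff, hn]
        refine (haC n).trans ?_
        gcongr ?_ * ?_
        apply Real.rpow_le_rpow_of_nonpos hMpos _ (by linarith)
        have : (M : ℝ) ≤ n := by exact_mod_cast not_lt.1 hnM
        linarith)
      refine ⟨closedBall c (2 * (δ ^ θ / 4)), ?_, hyc⟩
      exact Finset.mem_coe.2 (Finset.mem_union_left _ (Finset.mem_image.2 ⟨c, hc, rfl⟩))
  · intro U hU
    rcases Finset.mem_union.1 (Finset.mem_coe.1 hU) with hU | hU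
    · rw [hT0 U hU]; exact ⟨hδθ, le_rfl⟩
    · rw [hT1 U hU]; exact ⟨le_rfl, hδθ⟩
  · have hsum0 : ∑ U ∈ T0, diam U ^ s ≤ K0 * δ ^ e1 + K1 * δ ^ (θ * s) := by
      rw [Finset.sum_congr rfl fun U hU => by rw [hT0 U hU], Finset.sum_const, nsmul_eq_mul,
        ← Real.rpow_mul hδpos.le]
      have c1 : (T0.card : ℝ) ≤ F0.card := by exact_mod_cast Finset.card_image_le
      have c2 : C * (M : ℝ) ^ (-p) / (δ ^ θ / 4) ≤ 4 * C * δ ^ (p * x - θ) := by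
        have : (M : ℝ) ^ (-p) ≤ δ ^ (p * x) := by
          calc (M : ℝ) ^ (-p) ≤ (δ ^ (-x)) ^ (-p) :=
                Real.rpow_le_rpow_of_nonpos (by positivity) hM1 (by linarith)
            _ = _ := by rw [← Real.rpow_mul hδpos.le]; congr 1; ring
        rw [Real.rpow_sub hδpos]
        calc C * (M : ℝ) ^ (-p) / (δ ^ θ / 4) ≤ C * δ ^ (p * x) / (δ ^ θ / 4) := by gcongr
          _ = _ := by field_simp
      have c3 : (C * (M : ℝ) ^ (-p) / (δ ^ θ / 4) + 1) ^ (m + 1) ≤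
          2 ^ (m + 1) * ((4 * C * δ ^ (p * x - θ)) ^ (m + 1) + 1) := by
        set z := 4 * C * δ ^ (p * x - θ) with hz
        have hz0 : 0 ≤ z := by positivity
        calc (C * (M : ℝ) ^ (-p) / (δ ^ θ / 4) + 1) ^ (m + 1) ≤ (2 * max z 1) ^ (m + 1) := by
              gcongr
              linarith [le_max_left z 1, le_max_right z 1]
          _ = 2 ^ (m + 1) * (max z 1) ^ (m + 1) := mul_pow _ _ _
          _ ≤ _ := by
            gcongr
            rcases le_total z 1 with h | h
            · rw [max_eq_right h, one_pow]
              have : 0 ≤ z ^ (m + 1) := by positivity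
              linarith
            · rw [max_eq_left h]; linarith
      have c4 : δ ^ e1 = (δ ^ (p * x - θ)) ^ (m + 1) * δ ^ (θ * s) := by
        rw [← Real.rpow_natCast, ← Real.rpow_mul hδpos.le, ← Real.rpow_add hδpos]
        push_cast; rfl
      calc (T0.card : ℝ) * δ ^ (θ * s) ≤
          2 ^ (m + 1) * ((4 * C * δ ^ (p * x - θ)) ^ (m + 1) + 1) * δ ^ (θ * s) := by
            gcongr
            exact c1.trans (hF0c.trans c3)
        _ = _ := by rw [c4, hK0, hK1, mul_pow (4 * C)]; ring
    have hsum1 : ∑ U ∈ T1, diam U ^ s ≤ K2 * δ ^ e2 := by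
      rw [Finset.sum_congr rfl fun U hU => by rw [hT1 U hU], Finset.sum_const, nsmul_eq_mul]
      have c1 : (T1.card : ℝ) ≤ ∑ n ∈ Finset.range M, ((F n).card : ℝ) := by
        have : T1.card ≤ ∑ n ∈ Finset.range M, (F n).card :=
          Finset.card_biUnion_le.trans (Finset.sum_le_sum fun n _ => Finset.card_image_le)
        exact_mod_cast this
      have c2 : ∀ n ∈ Finset.range M, ((F n).card : ℝ) ≤
          2 * (m + 1) * (4 * C + 2 ^ p) ^ m * δ ^ (-(m : ℝ)) * ((n : ℝ) + 1) ^ (-(p * m)) := by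
        intro n hn
        have hn' : (n : ℝ) + 1 ≤ M := by exact_mod_cast Finset.mem_range.1 hn
        set k := ((n : ℝ) + 1) ^ (-p) with hk
        have hkpos : 0 < k := by positivity
        have d1 : δ ≤ 2 ^ p * k := by
          have : (2 : ℝ) ^ (-p) * δ ^ (p * x) ≤ k := by
            calc (2 : ℝ) ^ (-p) * δ ^ (p * x) = (2 * δ ^ (-x)) ^ (-p) := by
                  rw [Real.mul_rpow (by positivity) (by positivity), ← Real.rpow_mul hδpos.le]
                  congr 2; ring
              _ ≤ k := Real.rpow_le_rpow_of_nonpos (by positivity) (hn'.trans hM2) (by linarith)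
          have d2 : δ ≤ δ ^ (p * x) := by
            simpa using Real.rpow_le_rpow_of_exponent_ge hδpos hδ1.le h3
          calc δ ≤ δ ^ (p * x) := d2
            _ = 2 ^ p * (2 ^ (-p) * δ ^ (p * x)) := by
              rw [← mul_assoc, ← Real.rpow_add two_pos]; simp
            _ ≤ _ := by gcongr
        have d3 : a n / (δ / 4) + 1 ≤ (4 * C + 2 ^ p) * (δ⁻¹ * k) := by
          have : 1 ≤ 2 ^ p * k * δ⁻¹ := by
            rw [← div_eq_mul_inv, one_le_div hδpos]; exact d1
          calc a n / (δ / 4) + 1 ≤ C * k / (δ / 4) + 2 ^ p * k * δ⁻¹ := by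
                gcongr; exact haC n
            _ = _ := by field_simp
        have han := hapos n
        calc ((F n).card : ℝ) ≤ 2 * (m + 1) * (a n / (δ / 4) + 1) ^ m := hFc n
          _ ≤ 2 * (m + 1) * ((4 * C + 2 ^ p) * (δ⁻¹ * k)) ^ m := by gcongr
          _ = _ := by
            have f1 : δ ^ (-(m : ℝ)) = δ⁻¹ ^ m := by
              rw [Real.rpow_neg hδpos.le, Real.rpow_natCast, inv_pow]
            have f2 : ((n : ℝ) + 1) ^ (-(p * m)) = k ^ m := by
              rw [hk, ← Real.rpow_natCast, ← Real.rpow_mul (by positivity)]; congr 1; ring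
            rw [f1, f2, mul_pow, mul_pow]; ring
      have c3 := c1.trans (Finset.sum_le_sum c2)
      rw [← Finset.mul_sum] at c3
      have c4 := sum_bound (p * m) η hη M hMn
      rw [← hβ] at c4
      have c5 : (M : ℝ) ^ β ≤ 2 ^ β * δ ^ (-(x * β)) := by
        calc (M : ℝ) ^ β ≤ (2 * δ ^ (-x)) ^ β := Real.rpow_le_rpow hMpos.le hM2 hβpos.le
          _ = _ := by
            rw [Real.mul_rpow (by positivity) (by positivity), ← Real.rpow_mul hδpos.le]
            congr 2; ring
      have c6 : δ ^ e2 = δ ^ (-(m : ℝ)) * δ ^ (-(x * β)) * δ ^ s := by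
        rw [← Real.rpow_add hδpos, ← Real.rpow_add hδpos]; congr 1; rw [he2]; ring
      calc (T1.card : ℝ) * δ ^ s ≤ (2 * (m + 1) * (4 * C + 2 ^ p) ^ m * δ ^ (-(m : ℝ)) *
            ((1 + 1 / η) * (2 ^ β * δ ^ (-(x * β))))) * δ ^ s := by
            gcongr
            refine c3.trans ?_
            gcongr
            refine c4.trans ?_
            gcongr
        _ = _ := by rw [c6, hK2]; ring
    have e := Finset.tsum_subtype (T0 ∪ T1) (fun U : Set (X m) => ENNReal.ofReal (diam U ^ s))
    refine le_trans (le_of_eq e) ?_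
    rw [← ENNReal.ofReal_sum_of_nonneg (fun U _ => Real.rpow_nonneg diam_nonneg _)]
    apply ENNReal.ofReal_le_ofReal
    have h5 : ∑ U ∈ T0 ∪ T1, diam U ^ s ≤ ∑ U ∈ T0, diam U ^ s + ∑ U ∈ T1, diam U ^ s := by
      rw [← Finset.sum_union_inter]
      have : 0 ≤ ∑ U ∈ T0 ∩ T1, diam U ^ s :=
        Finset.sum_nonneg fun U _ => Real.rpow_nonneg diam_nonneg _
      linarith
    have hcost' : K0 * δ ^ e1 + K1 * δ ^ (θ * s) + K2 * δ ^ e2 < ε := hcost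
    linarith

lemma upper_large (m : ℕ) (p θ s C : ℝ) (hp : 0 < p) (hθ : 0 < θ) (hθ' : θ ≤ 1)
    (hs : (m : ℝ) + 1 ≤ s) (hC : 0 < C) (a : ℕ → ℝ) (hapos : ∀ n, 0 < a n)
    (haC : ∀ n : ℕ, a n ≤ C * ((n : ℝ) + 1) ^ (-p)) :
    s ∈ Adm θ (concentricSeq (m + 1) a) := by
  have hm : (0 : ℝ) ≤ m := Nat.cast_nonneg m
  have hx : 0 < 1 / (1 + p) := by positivity
  have hx1 : 1 / (1 + p) < 1 := by rw [div_lt_one (by positivity)]; linarith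
  refine upper m p θ s (1 / (1 + p)) C hp hθ hθ' hx (by linarith) hC a hapos haC ?_ ?_ ?_
  · have h1 : max 0 (1 - p * m) ≤ 1 := max_le zero_le_one (by nlinarith)
    have h0 : 0 ≤ max 0 (1 - p * m) := le_max_left _ _
    nlinarith
  · have : 0 < p * (1 / (1 + p)) * (m + 1) := by positivity
    nlinarith
  · rw [mul_one_div, div_le_one (by positivity)]; linarith

lemma seq_bound (p : ℝ) (hp : 0 < p) (a : ℕ → ℝ) (hapos : ∀ n, 0 < a n)
    (hsup : limsup (fun n : ℕ => ((a n * (n : ℝ) ^ p : ℝ) : EReal)) atTop < 1) :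
    ∃ C : ℝ, 0 < C ∧ ∀ n : ℕ, a n ≤ C * ((n : ℝ) + 1) ^ (-p) := by
  have hev := eventually_lt_of_limsup_lt hsup
  have hev2 : ∀ᶠ n : ℕ in atTop, a n * ((n : ℝ) + 1) ^ p ≤ 2 ^ p := by
    filter_upwards [hev, eventually_ge_atTop 1] with n hn hn1
    have hn' : a n * (n : ℝ) ^ p < 1 := by exact_mod_cast hn
    have hn1' : (1 : ℝ) ≤ n := by exact_mod_cast hn1
    calc a n * ((n : ℝ) + 1) ^ p ≤ a n * (2 * n) ^ p := by
          have := (hapos n).le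
          gcongr
          linarith
      _ = 2 ^ p * (a n * (n : ℝ) ^ p) := by
          rw [Real.mul_rpow two_pos.le (by positivity)]; ring
      _ ≤ 2 ^ p * 1 := by gcongr
      _ = _ := mul_one _
  have hb : BddAbove (range fun n : ℕ => a n * ((n : ℝ) + 1) ^ p) :=
    IsBoundedUnder.bddAbove_range ⟨2 ^ p, by simpa using hev2⟩
  obtain ⟨C, hC⟩ := hb
  have hC' : ∀ n : ℕ, a n * ((n : ℝ) + 1) ^ p ≤ C := fun n => hC ⟨n, rfl⟩
  refine ⟨C, ?_, fun n => ?_⟩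
  · have := hC' 0
    have h0 := hapos 0
    simp at this
    linarith
  · rw [Real.rpow_neg (by positivity), ← div_eq_mul_inv, le_div_iff₀ (by positivity)]
    exact hC' n

lemma concentric_eq (d : ℕ) (p : ℝ) :
    concentric d p = concentricSeq d (fun n : ℕ => ((n : ℝ) + 1) ^ (-p)) := by
  ext x
  constructor
  · rintro ⟨n, hn, hx⟩
    refine ⟨n - 1, ?_⟩
    rw [hx]
    congr 1
    have : ((n - 1 + 1 : ℕ) : ℝ) = n := by rw [Nat.sub_add_cancel hn]
    rw [← this]; push_cast; rfl
  · rintro ⟨n, hx⟩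
    exact ⟨n + 1, by omega, by rw [hx]; push_cast; rfl⟩

lemma main (m : ℕ) (p : ℝ) (hp : 0 < p) (a : ℕ → ℝ) (hapos : ∀ n, 0 < a n)
    (hsup : limsup (fun n : ℕ => ((a n * (n : ℝ) ^ p : ℝ) : EReal)) atTop < 1)
    (θ : ℝ) (hθ : 0 < θ) (hθ' : θ ≤ 1) :
    updim θ (concentricSeq (m + 1) a) ≤ updim θ (concentric (m + 1) p) := by
  obtain ⟨C, hC, haC⟩ := seq_bound p hp a hapos hsup
  have hne : (Adm θ (concentric (m + 1) p)).Nonempty := by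
    refine ⟨m + 1, ?_⟩
    rw [concentric_eq]
    exact upper_large m p θ _ 1 hp hθ hθ' le_rfl one_pos _ (fun n => by positivity)
      (fun n => by rw [one_mul])
  have hsub : Adm θ (concentric (m + 1) p) ⊆ Adm θ (concentricSeq (m + 1) a) := by
    intro s hs
    rcases le_or_gt ((m : ℝ) + 1) s with h | h
    · exact upper_large m p θ s C hp hθ hθ' h hC a hapos haC
    have hms := lower_one m p θ s hθ hs
    set x := ((s - m) + θ * (m + 1 - s)) / (1 + p) with hxdef
    have hx : x * (1 + p) = (s - m) + θ * (m + 1 - s) := by rw [hxdef]; field_simp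
    have hl := lower_two m p θ s x hp hθ hs h hx
    have hθt : 0 < θ * (m + 1 - s) := mul_pos hθ (by linarith)
    have hx0 : 0 < x := by positivity
    have hm : (0 : ℝ) ≤ m := Nat.cast_nonneg m
    refine upper m p θ s x C hp hθ hθ' hx0 (by linarith) hC a hapos haC ?_ ?_ ?_
    · rcases le_total 0 (1 - p * m) with h' | h'
      · rw [max_eq_right h']; exact hl
      · rw [max_eq_left h']; linarith
    · linarith
    · have : θ * (m + 1 - s) ≤ 1 * (m + 1 - s) := by gcongr
      linarith
  exact csInf_le_csInf ⟨0, fun s hs => hs.1⟩ hne hsub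

end ConcAux

theorem stmt5 (d : ℕ) (hd : 2 ≤ d) (p : ℝ) (hp : 0 < p) (a : ℕ → ℝ)
    (ha : StrictAnti a) (hapos : ∀ n, 0 < a n) (halim : Tendsto a atTop (nhds 0))
    (hsup : limsup (fun n : ℕ => ((a n * (n : ℝ) ^ p : ℝ) : EReal)) atTop < 1)
    (θ : ℝ) (hθ : 0 < θ) (hθ' : θ ≤ 1) :
    updim θ (concentricSeq d a) ≤ updim θ (concentric d p) := by

  obtain ⟨m, rfl⟩ : ∃ m, d = m + 1 := ⟨d - 1, by omega⟩
  exact ConcAux.main m p hp a hapos hsup θ hθ hθ'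
end
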